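/- arXiv:1808.04598 — 10 statements merged into one kernel-verified Lean document; each statement's English description precedes it below -/
import Mathlib

section
/- For every real a, lim_{n→∞} n! · P(X_n ≤ 1 + a/n) = e^{a−1}, where X_n is a Gamma(n,1)-distributed random variable (the sum of n independent standard exponentials). Equivalently, the expected number of oriented paths on the n-dimensional hypercube with weight at most 1 + a/n converges to e^{a−1} = ∫_{−∞}^a e^{x−1} dx. -/
open MeasureTheory ProbabilityTheory Real Filter

lemma lightPaths_prob (m : ℕ) (c : ℝ) (hc : 0 ≤ c) :
    ((m + 1).factorial : ℝ) * ((gammaMeasure ((m + 1 : ℕ) : ℝ) 1) (Set.Iic c)).toReal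
      = (m + 1) * ∫ x in (0:ℝ)..c, x ^ m * Real.exp (-x) := by
  have hm : (0:ℝ) < ((m + 1 : ℕ) : ℝ) := by positivity
  have : IsProbabilityMeasure (gammaMeasure ((m + 1 : ℕ) : ℝ) 1) :=
    isProbabilityMeasure_gammaMeasure hm one_pos
  have h1 := cdf_gammaMeasure_eq_integral hm one_pos c
  rw [cdf_eq_real, measureReal_def] at h1
  rw [h1]
  have h2 : ∫ x in Set.Iic c, gammaPDFReal ((m + 1 : ℕ) : ℝ) 1 x
      = ∫ x in Set.Icc 0 c, (m.factorial : ℝ)⁻¹ * (x ^ m * Real.exp (-x)) := by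
    rw [← integral_indicator measurableSet_Iic, ← integral_indicator measurableSet_Icc]
    congr 1
    funext x
    simp only [Set.indicator, Set.mem_Iic, Set.mem_Icc, gammaPDFReal]
    by_cases hx : 0 ≤ x <;> by_cases hxc : x ≤ c <;> simp [hx, hxc]
    rw [Real.Gamma_nat_eq_factorial]
    ring
  rw [h2, integral_Icc_eq_integral_Ioc, ← intervalIntegral.integral_of_le hc,
    intervalIntegral.integral_const_mul, Nat.factorial_succ]
  have : (m.factorial : ℝ) ≠ 0 := by positivity
  push_cast
  field_simp

lemma lightPaths_lower (m : ℕ) (c : ℝ) (hc : 0 ≤ c) :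
    c ^ (m + 1) * Real.exp (-c) ≤ (m + 1) * ∫ x in (0:ℝ)..c, x ^ m * Real.exp (-x) := by
  have h : ∫ x in (0:ℝ)..c, x ^ m * Real.exp (-c) ≤ ∫ x in (0:ℝ)..c, x ^ m * Real.exp (-x) := by
    apply intervalIntegral.integral_mono_on hc
    · exact Continuous.intervalIntegrable (by fun_prop) _ _
    · exact Continuous.intervalIntegrable (by fun_prop) _ _
    · intro x hx
      have := hx.1
      have := hx.2
      gcongr
  have h2 : (m + 1 : ℝ) * ∫ x in (0:ℝ)..c, x ^ m * Real.exp (-c) = c ^ (m + 1) * Real.exp (-c) := by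
    rw [intervalIntegral.integral_mul_const, integral_pow]
    field_simp
    simp
  rw [← h2]
  gcongr

lemma lightPaths_upper (m : ℕ) (c : ℝ) (hc : 0 ≤ c) :
    (m + 1) * ∫ x in (0:ℝ)..c, x ^ m * Real.exp (-x)
      ≤ c ^ (m + 1) * Real.exp (-c) + c ^ (m + 1) * c * (1 / ((m + 1 : ℕ) + 1 : ℝ)) := by
  have h : ∫ x in (0:ℝ)..c, x ^ m * Real.exp (-x)
      ≤ ∫ x in (0:ℝ)..c, (x ^ m * (Real.exp (-c) + c) - x ^ (m + 1)) := by
    apply intervalIntegral.integral_mono_on hc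
    · exact Continuous.intervalIntegrable (by fun_prop) _ _
    · exact Continuous.intervalIntegrable (by fun_prop) _ _
    · intro x hx
      have h0 := hx.1
      have h1 := hx.2
      have e1 : Real.exp (-x) ≤ 1 := by simpa using h0
      have e2 : Real.exp (-c) = Real.exp (-x) * Real.exp (-(c - x)) := by
        rw [← Real.exp_add]; ring_nf
      have e3 := Real.add_one_le_exp (-(c - x))
      have e4 : Real.exp (-x) ≤ Real.exp (-c) + (c - x) := by
        nlinarith [Real.exp_pos (-x)]
      have := mul_le_mul_of_nonneg_left e4 (pow_nonneg h0 m)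
      calc _ ≤ _ := this
        _ = _ := by ring
  have h2 : (m + 1 : ℝ) * ∫ x in (0:ℝ)..c, (x ^ m * (Real.exp (-c) + c) - x ^ (m + 1))
      = c ^ (m + 1) * Real.exp (-c) + c ^ (m + 1) * c * (1 / ((m + 1 : ℕ) + 1 : ℝ)) := by
    rw [intervalIntegral.integral_sub (Continuous.intervalIntegrable (by fun_prop) _ _)
      (Continuous.intervalIntegrable (by fun_prop) _ _),
      intervalIntegral.integral_mul_const, integral_pow, integral_pow]
    push_cast
    simp
    field_simp
    ring
  rw [← h2]
  gcongr

/-- For `X_n` Gamma(n,1)-distributed, `n! ⬝ P(X_n ≤ 1 + a/n) → e^{a-1}` as `n → ∞`. -/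
theorem expected_number_of_light_paths (a : ℝ) :
    Tendsto
      (fun n : ℕ =>
        (n.factorial : ℝ) * ((gammaMeasure (n : ℝ) 1) (Set.Iic (1 + a / n))).toReal)
      atTop (nhds (Real.exp (a - 1))) := by
  have hc : Tendsto (fun n : ℕ => 1 + a / (n : ℝ)) atTop (nhds 1) := by
    simpa using (tendsto_const_div_atTop_nhds_zero_nat a).const_add 1
  have hp : Tendsto (fun n : ℕ => (1 + a / (n : ℝ)) ^ n) atTop (nhds (Real.exp a)) :=
    Real.tendsto_one_add_div_pow_exp a
  have he : Tendsto (fun n : ℕ => Real.exp (-(1 + a / (n : ℝ)))) atTop (nhds (Real.exp (-1))) :=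
    (Real.continuous_exp.tendsto _).comp hc.neg
  have hl := hp.mul he
  rw [← Real.exp_add, ← sub_eq_add_neg] at hl
  have hu := hl.add ((hp.mul hc).mul (tendsto_one_div_add_atTop_nhds_zero_nat (𝕜 := ℝ)))
  rw [mul_zero, add_zero] at hu
  have hev : ∀ᶠ n : ℕ in atTop, 0 ≤ 1 + a / (n : ℝ) :=
    (hc.eventually (lt_mem_nhds one_pos)).mono fun _ h => h.le
  refine tendsto_of_tendsto_of_tendsto_of_le_of_le' hl hu ?_ ?_
  · filter_upwards [hev, eventually_ge_atTop 1] with n hn h1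
    obtain ⟨m, rfl⟩ := Nat.exists_eq_add_of_le' h1
    rw [lightPaths_prob m _ hn]
    exact lightPaths_lower m _ hn
  · filter_upwards [hev, eventually_ge_atTop 1] with n hn h1
    obtain ⟨m, rfl⟩ := Nat.exists_eq_add_of_le' h1
    rw [lightPaths_prob m _ hn]
    exact lightPaths_upper m _ hn
end

section
/- Let n ≥ 1 and let X_n be a Gamma(n,1)-distributed random variable (the sum of n independent standard exponentials). Then for every x > 0: e^{−x}·x^n/n! ≤ P(X_n ≤ x) ≤ (1 + e^{x}·x/(n+1)) · e^{−x}·x^n/n!. -/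
open MeasureTheory ProbabilityTheory Real

lemma gamma_cdf_aux (m : ℕ) (x : ℝ) (hx : 0 < x) :
    ((gammaMeasure ((m + 1 : ℕ) : ℝ) 1) (Set.Iic x)).toReal
      = ∫ t in (0:ℝ)..x, t ^ m * Real.exp (-t) / m.factorial := by
  have ha : (0:ℝ) < ((m + 1 : ℕ) : ℝ) := by positivity
  have := isProbabilityMeasure_gammaMeasure ha one_pos
  have h1 := cdf_gammaMeasure_eq_integral ha one_pos x
  rw [cdf_eq_real] at h1
  change (gammaMeasure ((m + 1 : ℕ) : ℝ) 1).real (Set.Iic x) = _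
  rw [h1, intervalIntegral.integral_of_le hx.le, ← integral_Icc_eq_integral_Ioc]
  rw [setIntegral_eq_of_subset_of_forall_sdiff_eq_zero (s := Set.Icc 0 x) measurableSet_Iic
    (fun t ht => ht.2)]
  · refine setIntegral_congr_fun measurableSet_Icc ?_
    intro t ht
    simp only [gammaPDFReal, if_pos ht.1]
    have h2 : ((m + 1 : ℕ) : ℝ) - 1 = (m : ℝ) := by push_cast; ring
    rw [h2, Real.one_rpow, Real.rpow_natCast]
    push_cast
    rw [Real.Gamma_nat_eq_factorial, one_mul]
    ring
  · intro t ht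
    have : ¬ 0 ≤ t := fun h => ht.2 ⟨h, ht.1⟩
    simp only [gammaPDFReal, if_neg this]

/-- Tail estimates for the Gamma(n,1) distribution: for `x > 0`,
`e^{-x} x^n / n! ≤ P(X_n ≤ x) ≤ (1 + e^x x/(n+1)) e^{-x} x^n / n!`. -/
theorem gamma_tail_estimates (n : ℕ) (hn : 1 ≤ n) (x : ℝ) (hx : 0 < x) :
    Real.exp (-x) * x ^ n / n.factorial ≤ ((gammaMeasure (n : ℝ) 1) (Set.Iic x)).toReal ∧
    ((gammaMeasure (n : ℝ) 1) (Set.Iic x)).toReal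
      ≤ (1 + Real.exp x * x / (n + 1)) * (Real.exp (-x) * x ^ n / n.factorial) := by
  obtain ⟨m, rfl⟩ : ∃ m, n = m + 1 := ⟨n - 1, by omega⟩
  rw [gamma_cdf_aux m x hx]
  have hm : (0:ℝ) < m.factorial := by positivity
  have hf : ((m + 1).factorial : ℝ) = (m + 1) * m.factorial := by
    rw [Nat.factorial_succ]; push_cast; ring
  have hi : IntervalIntegrable (fun t : ℝ => t ^ m * Real.exp (-t) / m.factorial) volume 0 x :=
    Continuous.intervalIntegrable (by fun_prop) _ _
  constructor
  · have h1 : ∫ t in (0:ℝ)..x, t ^ m * Real.exp (-x) / m.factorial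
        = Real.exp (-x) * x ^ (m + 1) / (m + 1).factorial := by
      rw [intervalIntegral.integral_div, intervalIntegral.integral_mul_const, integral_pow, hf]
      field_simp
      simp
    rw [← h1]
    refine intervalIntegral.integral_mono_on hx.le
      (Continuous.intervalIntegrable (by fun_prop) _ _) hi ?_
    intro t ht
    have := ht.1
    have h2 : Real.exp (-x) ≤ Real.exp (-t) := Real.exp_le_exp.2 (by linarith [ht.2])
    gcongr
  · have hd : ∀ t : ℝ, HasDerivAt
        (fun t : ℝ => Real.exp (-t) * t ^ (m + 1) / (m + 1).factorial
          + t ^ (m + 2) / ((m + 2) * (m + 1).factorial))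
        (t ^ m * Real.exp (-t) / m.factorial
          + (1 - Real.exp (-t)) * t ^ (m + 1) / (m + 1).factorial) t := by
      intro t
      have a := ((((hasDerivAt_id t).neg.exp).mul (hasDerivAt_pow (m + 1) t)).div_const
        ((m + 1).factorial : ℝ)).add
        ((hasDerivAt_pow (m + 2) t).div_const (((m : ℝ) + 2) * (m + 1).factorial))
      refine a.congr_deriv ?_
      rw [hf]
      push_cast
      simp
      field_simp
      ring
    have h1 := intervalIntegral.integral_eq_sub_of_hasDerivAt (a := 0) (b := x)
      (fun t _ => hd t) (Continuous.intervalIntegrable (by fun_prop) _ _)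
    have h2 : (1 + Real.exp x * x / (((m + 1 : ℕ) : ℝ) + 1))
        * (Real.exp (-x) * x ^ (m + 1) / (m + 1).factorial)
        = ∫ t in (0:ℝ)..x, (t ^ m * Real.exp (-t) / m.factorial
          + (1 - Real.exp (-t)) * t ^ (m + 1) / (m + 1).factorial) := by
      rw [h1, Real.exp_neg]
      have h3 : (m : ℝ) + 1 + 1 = m + 2 := by ring
      push_cast
      rw [h3]
      simp
      field_simp
      ring
    rw [h2]
    refine intervalIntegral.integral_mono_on hx.le hi
      (Continuous.intervalIntegrable (by fun_prop) _ _) ?_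
    intro t ht
    have h0 := ht.1
    have h4 : 0 ≤ 1 - Real.exp (-t) := by
      have : Real.exp (-t) ≤ 1 := Real.exp_le_one_iff.2 (by linarith)
      linarith
    have : 0 ≤ (1 - Real.exp (-t)) * t ^ (m + 1) / (m + 1).factorial := by positivity
    linarith
end

section
/- For every t ≥ 0, lim_{n→∞} ( ∫₀^∞ e^{−x} · exp(−t·e^{−n x}) dx )^n = exp( ∫₀^∞ ( exp(−t·e^{−x}) − 1 ) dx ). (The left-hand side is the Laplace transform at t of Σ_{i=1}^n exp(−n ξ_i) for i.i.d. standard exponentials ξ_i; the right-hand side is the Laplace transform at t of Σ_i exp(−η_i) for a Poisson point process (η_i) with intensity dx on ℝ₊.) -/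
open MeasureTheory Real Filter

lemma aux_limit (t : ℝ) (ht : 0 ≤ t) :
    Tendsto (fun n : ℕ => ∫ y in Set.Ioi (0 : ℝ),
        Real.exp (-((n : ℝ)⁻¹ * y)) * (Real.exp (-t * Real.exp (-y)) - 1)) atTop
      (nhds (∫ x in Set.Ioi (0 : ℝ), (Real.exp (-t * Real.exp (-x)) - 1))) := by
  apply tendsto_integral_of_dominated_convergence (fun y => t * Real.exp (-y))
  · intro n
    exact (by fun_prop : Continuous _).aestronglyMeasurable
  · exact (integrableOn_exp_neg_Ioi 0).const_mul t
  · intro n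
    refine (ae_restrict_iff' measurableSet_Ioi).2 (Eventually.of_forall fun y hy => ?_)
    have hy' : (0 : ℝ) < y := hy
    have hE : Real.exp (-((n : ℝ)⁻¹ * y)) ≤ 1 := by
      apply Real.exp_le_one_iff.2
      have : 0 ≤ (n : ℝ)⁻¹ * y := by positivity
      linarith
    have h1 : Real.exp (-t * Real.exp (-y)) ≤ 1 := by
      apply Real.exp_le_one_iff.2
      have : 0 ≤ t * Real.exp (-y) := by positivity
      linarith
    have h2 := Real.add_one_le_exp (-t * Real.exp (-y))
    rw [norm_mul, Real.norm_eq_abs, Real.norm_eq_abs, abs_of_pos (Real.exp_pos _),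
      abs_of_nonpos (by linarith)]
    calc _ ≤ 1 * -(Real.exp (-t * Real.exp (-y)) - 1) :=
          mul_le_mul_of_nonneg_right hE (by linarith)
      _ ≤ _ := by linarith
  · refine Eventually.of_forall fun y => ?_
    have h0 : Tendsto (fun n : ℕ => (n : ℝ)⁻¹) atTop (nhds 0) :=
      tendsto_inv_atTop_nhds_zero_nat
    have h1 : Tendsto (fun n : ℕ => Real.exp (-((n : ℝ)⁻¹ * y))) atTop (nhds 1) := by
      have := (Real.continuous_exp.tendsto _).comp (h0.mul_const y).neg
      simpa [Function.comp_def] using this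
    simpa using h1.mul_const (Real.exp (-t * Real.exp (-y)) - 1)

lemma aux_eq (t : ℝ) (ht : 0 ≤ t) (n : ℕ) (hn : 0 < n) :
    ∫ x in Set.Ioi (0 : ℝ), Real.exp (-x) * Real.exp (-t * Real.exp (-(n : ℝ) * x)) =
      1 + (n : ℝ)⁻¹ * ∫ y in Set.Ioi (0 : ℝ),
        Real.exp (-((n : ℝ)⁻¹ * y)) * (Real.exp (-t * Real.exp (-y)) - 1) := by
  have hn' : (0 : ℝ) < n := by exact_mod_cast hn
  have h := integral_comp_mul_left_Ioi (fun y : ℝ =>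
    Real.exp (-((n : ℝ)⁻¹ * y)) * (Real.exp (-t * Real.exp (-y)) - 1)) 0 hn'
  rw [mul_zero, smul_eq_mul] at h
  rw [← h]
  nth_rewrite 1 [← integral_exp_neg_Ioi_zero]
  rw [← integral_add (integrableOn_exp_neg_Ioi 0)]
  · congr 1
    ext x
    rw [inv_mul_cancel_left₀ hn'.ne', neg_mul (n : ℝ)]
    ring
  · refine Integrable.mono' (integrableOn_exp_neg_Ioi 0)
      (by fun_prop : Continuous _).aestronglyMeasurable (Eventually.of_forall fun x => ?_)
    have h1 : Real.exp (-t * Real.exp (-((n : ℝ) * x))) ≤ 1 := by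
      apply Real.exp_le_one_iff.2
      have : 0 ≤ t * Real.exp (-((n : ℝ) * x)) := by positivity
      linarith
    have h2 := Real.exp_pos (-t * Real.exp (-((n : ℝ) * x)))
    rw [inv_mul_cancel_left₀ hn'.ne', norm_mul, Real.norm_eq_abs, Real.norm_eq_abs,
      abs_of_pos (Real.exp_pos _)]
    exact mul_le_of_le_one_right (Real.exp_pos _).le (abs_le.2 ⟨by linarith, by linarith⟩)



/-- Convergence of the Laplace transform of `∑_{i=1}^n exp (-n ξ_i)` (for i.i.d. standard
exponentials) to the Laplace transform of `∑_i exp (-η_i)` for a Poisson point process with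
intensity `dx` on `ℝ₊`, written as explicit integrals. -/
theorem laplace_transform_limit (t : ℝ) (ht : 0 ≤ t) :
    Tendsto
      (fun n : ℕ =>
        (∫ x in Set.Ioi (0 : ℝ), Real.exp (-x) * Real.exp (-t * Real.exp (-(n : ℝ) * x))) ^ n)
      atTop
      (nhds (Real.exp (∫ x in Set.Ioi (0 : ℝ), (Real.exp (-t * Real.exp (-x)) - 1)))) := by
  have key := Real.tendsto_one_add_pow_exp_of_tendsto (g := fun n : ℕ => (n : ℝ)⁻¹ *
    ∫ y in Set.Ioi (0 : ℝ),
      Real.exp (-((n : ℝ)⁻¹ * y)) * (Real.exp (-t * Real.exp (-y)) - 1))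
    (t := ∫ x in Set.Ioi (0 : ℝ), (Real.exp (-t * Real.exp (-x)) - 1)) ?_
  · refine key.congr' ?_
    filter_upwards [eventually_gt_atTop 0] with n hn
    rw [aux_eq t ht n hn]
  · refine (aux_limit t ht).congr' ?_
    filter_upwards [eventually_gt_atTop 0] with n hn
    have hn' : (n : ℝ) ≠ 0 := by exact_mod_cast hn.ne'
    rw [mul_inv_cancel_left₀ hn']
end

section
/- Define g : [0,1) → ℝ by g(γ) = (4(1−γ))^{1−γ} / (2−γ)^{2−γ}. Then: (i) g is monotone increasing on [2/3, 1); and (ii) for every γ ∈ [0, 2/3], g(γ) ≤ (3/4)^γ. -/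
open Real

noncomputable section

/-- The function `g(γ) = (4(1-γ))^{1-γ} / (2-γ)^{2-γ}` (real powers). -/
def gFun (γ : ℝ) : ℝ := (4 * (1 - γ)) ^ (1 - γ) / (2 - γ) ^ (2 - γ)

/-- Log-sum inequality. -/
lemma logsum_aux (x y : ℝ) (hx : 0 < x) (hy : 0 < y) :
    (1 + x) * (log (1 + x) - log (1 + y)) ≤ x * (log x - log y) := by
  have h1 : 0 < 1 + x := by linarith
  have h2 : 0 < 1 + y := by linarith
  have hsum : x / (1 + x) + 1 / (1 + x) = 1 := by
    rw [← add_div, add_comm x 1, div_self h1.ne']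
  have hc := strictConcaveOn_log_Ioi.concaveOn.2
    (Set.mem_Ioi.2 (div_pos hy hx)) (Set.mem_Ioi.2 (one_pos : (0 : ℝ) < 1))
    (show 0 ≤ x / (1 + x) by positivity) (show 0 ≤ 1 / (1 + x) by positivity) hsum
  simp only [smul_eq_mul, log_one, mul_zero, add_zero] at hc
  have he : x / (1 + x) * (y / x) + 1 / (1 + x) * 1 = (1 + y) / (1 + x) := by
    field_simp; ring
  rw [he, log_div hy.ne' hx.ne', log_div h2.ne' h1.ne', div_mul_eq_mul_div,
    div_le_iff₀ h1] at hc
  linarith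

/-- The logarithm of `gFun`. -/
def hAux (γ : ℝ) : ℝ :=
  (1 - γ) * (log 4 + log (1 - γ)) - (2 - γ) * log (2 - γ)

lemma gFun_eq_exp (γ : ℝ) (h : γ < 1) : gFun γ = exp (hAux γ) := by
  have h1 : 0 < 1 - γ := by linarith
  have h2 : 0 < 2 - γ := by linarith
  unfold gFun hAux
  rw [rpow_def_of_pos (by positivity), rpow_def_of_pos h2, ← exp_sub,
    log_mul (by norm_num) h1.ne']
  congr 1
  ring

/-- Tangent line inequality for `hAux`. -/
lemma hAux_tangent (a b : ℝ) (ha : a < 1) (hb : b < 1) :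
    hAux a + (b - a) * (log (2 - a) - log 4 - log (1 - a)) ≤ hAux b := by
  have := logsum_aux (1 - b) (1 - a) (by linarith) (by linarith)
  rw [show 1 + (1 - b) = 2 - b by ring, show 1 + (1 - a) = 2 - a by ring] at this
  unfold hAux
  linarith

/-- `g` is monotone increasing on `[2/3, 1)`, and `g(γ) ≤ (3/4)^γ` for `γ ∈ [0, 2/3]`. -/
theorem gFun_properties :
    MonotoneOn gFun (Set.Ico (2 / 3 : ℝ) 1) ∧
    ∀ γ ∈ Set.Icc (0 : ℝ) (2 / 3), gFun γ ≤ (3 / 4 : ℝ) ^ γ := by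
  constructor
  · intro a ha b hb hab
    rw [gFun_eq_exp a ha.2, gFun_eq_exp b hb.2, exp_le_exp]
    have ht := hAux_tangent a b ha.2 hb.2
    have h1 : 0 < 1 - a := by linarith [ha.2]
    have hl : log (4 * (1 - a)) ≤ log (2 - a) :=
      log_le_log (by positivity) (by linarith [ha.1])
    rw [log_mul (by norm_num) h1.ne'] at hl
    have := mul_nonneg (sub_nonneg.2 hab)
      (show 0 ≤ log (2 - a) - log 4 - log (1 - a) by linarith)
    linarith
  · intro γ hγ
    obtain ⟨h0, h1⟩ := hγ
    rw [gFun_eq_exp γ (by linarith), rpow_def_of_pos (by norm_num), exp_le_exp]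
    have t0 := hAux_tangent γ 0 (by linarith) (by norm_num)
    have t1 := hAux_tangent γ (2 / 3) (by linarith) (by norm_num)
    have e0 : hAux 0 = 0 := by
      have : log 4 = 2 * log 2 := by
        rw [show (4 : ℝ) = 2 ^ 2 by norm_num, log_pow]; norm_num
      unfold hAux
      norm_num
      linarith
    have e1 : hAux (2 / 3) = log (3 / 4) := by
      unfold hAux
      rw [show (1 : ℝ) - 2 / 3 = 1 / 3 by norm_num, show (2 : ℝ) - 2 / 3 = 4 / 3 by norm_num,
        log_div (by norm_num) (by norm_num), log_div (by norm_num) (by norm_num),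
        log_div (by norm_num) (by norm_num), log_one]
      ring
    have hneg : log (3 / 4 : ℝ) ≤ 0 := log_nonpos (by norm_num) (by norm_num)
    rw [e0] at t0
    rw [e1] at t1
    have m0 := mul_le_mul_of_nonneg_left t0 (sub_nonneg.2 h1)
    have m1 := mul_le_mul_of_nonneg_left t1 h0
    have m2 := mul_nonneg h0 (neg_nonneg.2 hneg)
    linarith

end
end

section
/- (Path counting, small overlap.) For a permutation σ of {1,…,n}, let k(σ) = #{ i ∈ {1,…,n} : σ({1,…,i−1}) = {1,…,i−1} and σ(i) = i } be the number of edges the corresponding oriented hypercube path shares with the identity path, and let f(n,k) = #{ σ : k(σ) = k }. Let K : ℕ → ℕ satisfy K(n)/n → 0. Then for every ε > 0 there exists N such that for all n ≥ N and all k with 1 ≤ k ≤ K(n): f(n,k) ≤ (1+ε)·(k+1)·(n−k)!. -/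
open Filter

/-- The path of `σ` shares its `i`-th edge (0-indexed) with the identity path exactly when
`σ` maps `{0, …, i-1}` onto itself and `σ i = i`. -/
def sharedEdge {n : ℕ} (σ : Equiv.Perm (Fin n)) (i : Fin n) : Prop :=
  (Finset.univ.filter (fun j => j < i)).image σ = Finset.univ.filter (fun j => j < i) ∧ σ i = i

instance {n : ℕ} (σ : Equiv.Perm (Fin n)) (i : Fin n) : Decidable (sharedEdge σ i) := by
  unfold sharedEdge; infer_instance

/-- The number of edges the path of `σ` shares with the identity path. -/
def kShared {n : ℕ} (σ : Equiv.Perm (Fin n)) : ℕ :=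
  (Finset.univ.filter (fun i => sharedEdge σ i)).card

/-- `f(n,k)`: the number of permutations of `{1,…,n}` whose path shares precisely `k` edges
with the identity path. -/
def fCount (n k : ℕ) : ℕ :=
  (Finset.univ.filter (fun σ : Equiv.Perm (Fin n) => kShared σ = k)).card


noncomputable section

open Polynomial in
def polB (a b : ℕ) : ℝ[X] := ∑ j ∈ Finset.Ico a b, Polynomial.monomial j (j.factorial : ℝ)

def G : ℕ → ℕ → ℝ
  | 0, m => m.factorial
  | k+1, m => ∑ p ∈ Finset.HasAntidiagonal.antidiagonal m, G k p.1 * p.2.factorial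

theorem G_nonneg (k m : ℕ) : 0 ≤ G k m := by
  induction k generalizing m with
  | zero => simp [G]
  | succ k ih => 
    simp only [G]
    exact Finset.sum_nonneg fun p _ => mul_nonneg (ih _) (by positivity)

theorem polB_coeff (a b j : ℕ) :
    (polB a b).coeff j = if a ≤ j ∧ j < b then (j.factorial : ℝ) else 0 := by
  simp [polB, Polynomial.coeff_monomial]

theorem polB_eval (a b : ℕ) (x : ℝ) :
    (polB a b).eval x = ∑ j ∈ Finset.Ico a b, (j.factorial : ℝ) * x ^ j := by
  simp [polB, Polynomial.eval_finsetSum]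

theorem polB_split (N h : ℕ) (hh : h ≤ N) :
    polB 0 (N+1) = polB 0 (h+1) + polB (h+1) (N+1) := by
  unfold polB
  rw [Finset.sum_Ico_consecutive _ (by omega) (by omega)]

theorem G_eq_coeff (N k m : ℕ) (hm : m ≤ N) : G k m = ((polB 0 (N+1))^(k+1)).coeff m := by
  induction k generalizing m with
  | zero =>
    rw [zero_add, pow_one, polB_coeff, if_pos (by omega)]
    rfl
  | succ k ih =>
    rw [pow_succ, Polynomial.coeff_mul]
    simp only [G]
    refine Finset.sum_congr rfl fun p hp => ?_
    rw [Finset.HasAntidiagonal.mem_antidiagonal] at hp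
    rw [ih _ (by omega), polB_coeff, if_pos (by omega)]

theorem polB_pow_nonneg (a b r j : ℕ) : 0 ≤ ((polB a b)^r).coeff j := by
  induction r generalizing j with
  | zero => simp [Polynomial.coeff_one]; split_ifs <;> norm_num
  | succ r ih =>
    rw [pow_succ, Polynomial.coeff_mul]
    refine Finset.sum_nonneg fun p _ => mul_nonneg (ih _) ?_
    rw [polB_coeff]; split_ifs <;> positivity

theorem sum_coeff_le_eval (P : Polynomial ℝ) (hP : ∀ j, 0 ≤ P.coeff j) (x : ℝ) (hx : 0 ≤ x)
    (s : Finset ℕ) : ∑ j ∈ s, P.coeff j * x ^ j ≤ P.eval x := by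
  rw [Polynomial.eval_eq_sum, Polynomial.sum]
  calc ∑ j ∈ s, P.coeff j * x ^ j ≤ ∑ j ∈ s ∪ P.support, P.coeff j * x ^ j :=
        Finset.sum_le_sum_of_subset_of_nonneg Finset.subset_union_left
          fun i _ _ => mul_nonneg (hP i) (by positivity)
    _ = ∑ j ∈ P.support, P.coeff j * x ^ j := by
        symm
        apply Finset.sum_subset Finset.subset_union_right
        intro i _ hi
        simp [Polynomial.notMem_support_iff.mp hi]

theorem sq_coeff_zero (N : ℕ) (Q : Polynomial ℝ) :
    (Q * (polB (N/2+1) (N+1))^2).coeff N = 0 := by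
  have h : (Polynomial.X : Polynomial ℝ)^(N/2+1) ∣ polB (N/2+1) (N+1) := by
    rw [Polynomial.X_pow_dvd_iff]
    intro d hd
    rw [polB_coeff, if_neg (by omega)]
  have h2 : (Polynomial.X : Polynomial ℝ)^((N/2+1)*2) ∣ Q * (polB (N/2+1) (N+1))^2 := by
    rw [pow_mul]
    exact Dvd.dvd.mul_left (pow_dvd_pow_of_dvd h 2) Q
  exact Polynomial.X_pow_dvd_iff.mp h2 N (by omega)

theorem fact_le (j : ℕ) : ((j+1).factorial : ℝ) ≤ 2 * (3 * (j+1) / 5)^j := by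
  induction j with
  | zero => norm_num
  | succ j ih =>
    rcases Nat.lt_or_ge j 2 with h | h
    · interval_cases j <;> norm_num [Nat.factorial]
    · have hj : (2:ℝ) ≤ j := by exact_mod_cast h
      have hb : (5/3 : ℝ) ≤ (1 + 1/((j:ℝ)+1))^j := by
        have := one_add_mul_le_pow (a := 1/((j:ℝ)+1)) (by have : 0 ≤ 1/((j:ℝ)+1) := by positivity
                                                          linarith) j
        refine le_trans ?_ this
        have : (2/3:ℝ) ≤ j * (1/((j:ℝ)+1)) := by
          rw [mul_one_div, le_div_iff₀ (by positivity)]; linarith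
        linarith
      rw [Nat.factorial_succ]
      push_cast
      have e : (3 * ((j:ℝ)+1+1)/5)^(j+1) =
          (3*((j:ℝ)+1)/5)^j * (1 + 1/((j:ℝ)+1))^j * (3*((j:ℝ)+1+1)/5) := by
        rw [← mul_pow, pow_succ]
        congr 2
        field_simp
      rw [e]
      have h0 : (0:ℝ) ≤ (3*((j:ℝ)+1)/5)^j := by positivity
      calc ((j:ℝ)+1+1) * ((j+1).factorial : ℝ) ≤ ((j:ℝ)+1+1) * (2 * (3 * (j+1) / 5)^j) := by gcongr
        _ = 2 * ((3*((j:ℝ)+1)/5)^j * (5/3) * (3*((j:ℝ)+1+1)/5)) := by ring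
        _ ≤ _ := by gcongr

theorem B_eval_le (m : ℕ) (hm : 1 ≤ m) : (polB 0 (m/2+1)).eval (3/(m:ℝ)) ≤ 1 + 60/m := by
  have hm' : (0:ℝ) < m := by exact_mod_cast hm
  rw [polB_eval, ← Finset.range_eq_Ico, Finset.sum_range_succ']
  have hterm : ∀ j ∈ Finset.range (m/2),
      (((j+1).factorial : ℝ)) * (3/(m:ℝ))^(j+1) ≤ 6/m * (9/10)^j := by
    intro j hj
    have hj' : 2 * ((j:ℝ)+1) ≤ m := by
      have : 2 * (j+1) ≤ m := by have := Finset.mem_range.mp hj; omega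
      exact_mod_cast this
    calc (((j+1).factorial : ℝ)) * (3/(m:ℝ))^(j+1)
        ≤ (2 * (3 * (j+1) / 5)^j) * (3/(m:ℝ))^(j+1) := by gcongr; exact fact_le j
      _ = 6/m * ((3 * (j+1) / 5) * (3/(m:ℝ)))^j := by rw [pow_succ, mul_pow]; ring
      _ ≤ 6/m * (9/10)^j := by
        gcongr
        rw [mul_div_assoc', div_le_iff₀ hm']
        linarith
  have h1 := Finset.sum_le_sum hterm
  rw [← Finset.mul_sum] at h1
  have h2 : ∑ j ∈ Finset.range (m/2), (9/10:ℝ)^j ≤ 10 := by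
    rw [geom_sum_eq (by norm_num)]
    have : (0:ℝ) ≤ (9/10)^(m/2) := by positivity
    rw [div_le_iff_of_neg (by norm_num)]
    linarith
  have h3 : 6/(m:ℝ) * ∑ j ∈ Finset.range (m/2), (9/10:ℝ)^j ≤ 6/m * 10 := by gcongr
  have h4 : 6/(m:ℝ) * 10 = 60/m := by ring
  simp only [Nat.factorial_zero, pow_zero, Nat.cast_one, mul_one]
  linarith

theorem fact_mul_pow_le (m M : ℕ) (hM : m/2+1 ≤ M) (hMm : M ≤ m) :
    (M.factorial : ℝ) * (3/(m:ℝ))^M ≤ m.factorial * (3/(m:ℝ))^m := by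
  have hm' : (0:ℝ) < m := by exact_mod_cast (by omega : 0 < m)
  obtain ⟨s, rfl⟩ := Nat.exists_eq_add_of_le hMm
  have h1 := Nat.pow_sub_le_descFactorial (M+s) s
  have h2 := Nat.factorial_mul_descFactorial (n := M+s) (k := s) (by omega)
  rw [Nat.add_sub_cancel] at h2
  rw [← h2, pow_add]
  have h3 : (1:ℝ) ≤ ((M+s).descFactorial s) * (3/((M+s : ℕ):ℝ))^s := by
    have h1' : (((M+s)+1-s : ℕ):ℝ)^s ≤ ((M+s).descFactorial s : ℝ) := by exact_mod_cast h1
    calc (1:ℝ) ≤ ((((M+s)+1-s : ℕ):ℝ) * (3/((M+s : ℕ):ℝ)))^s := by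
          apply one_le_pow₀
          rw [mul_div_assoc', le_div_iff₀ hm', one_mul]
          exact_mod_cast (by omega : M+s ≤ (M+s+1-s)*3)
      _ = (((M+s)+1-s : ℕ):ℝ)^s * (3/((M+s : ℕ):ℝ))^s := by rw [mul_pow]
      _ ≤ _ := by gcongr
  push_cast at h3 ⊢
  calc _ = (M.factorial : ℝ) * (3/((M:ℝ)+s))^M * 1 := by ring
    _ ≤ (M.factorial : ℝ) * (3/((M:ℝ)+s))^M * (((M+s).descFactorial s) * (3/((M:ℝ)+s))^s) := by
      gcongr
    _ = _ := by ring

theorem one_le_fact (m : ℕ) (hm : 1 ≤ m) :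
    1 ≤ (m.factorial : ℝ) * (3/(m:ℝ))^m * (Real.exp 1 / 3)^m := by
  have hm' : (0:ℝ) < m := by exact_mod_cast hm
  have := Real.pow_div_factorial_le_exp (m:ℝ) hm'.le m
  rw [div_le_iff₀ (by positivity)] at this
  have e : (m.factorial : ℝ) * (3/(m:ℝ))^m * (Real.exp 1 / 3)^m
      = Real.exp m * m.factorial / (m:ℝ)^m := by
    rw [mul_assoc, ← mul_pow]
    rw [← Real.exp_one_pow]
    have : 3/(m:ℝ) * (Real.exp 1 / 3) = Real.exp 1 / m := by field_simp
    rw [this, div_pow]; ring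
  rw [e, le_div_iff₀ (by positivity)]
  linarith

theorem G_le (k m : ℕ) (hm : 1 ≤ m) :
    G k m ≤ Real.exp (60 * (k+1) / m) * (1 + (Real.exp 1 / 3)^m) * (k+1) * m.factorial := by
  have hm' : (0:ℝ) < m := by exact_mod_cast hm
  set x : ℝ := 3/(m:ℝ) with hx
  have hx0 : 0 < x := by positivity
  set B := polB 0 (m/2+1) with hB
  set L := polB (m/2+1) (m+1) with hL
  set E := Real.exp (60 * (k+1) / m) with hE
  have hB1 : B.eval x ≤ 1 + 60/m := B_eval_le m hm
  have hB0 : 1 ≤ B.eval x := by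
    rw [hB, polB_eval, ← Finset.range_eq_Ico, Finset.sum_range_succ']
    have : 0 ≤ ∑ j ∈ Finset.range (m/2), ((j+1).factorial : ℝ) * x^(j+1) := by positivity
    simpa using this
  have hBE : (B.eval x)^(k+1) ≤ E := by
    calc (B.eval x)^(k+1) ≤ (Real.exp (60/m))^(k+1) := by
          gcongr
          have := Real.add_one_le_exp (60/(m:ℝ))
          linarith
      _ = E := by rw [← Real.exp_nat_mul, hE]; congr 1; push_cast; ring
  have hBE' : (B.eval x)^k ≤ E := le_trans (pow_le_pow_right₀ hB0 (by omega)) hBE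
  have hE0 : 0 < E := Real.exp_pos _
  have hG : G k m = (B^(k+1)).coeff m + (k+1) * (B^k * L).coeff m := by
    rw [G_eq_coeff m k m le_rfl, polB_split m (m/2) (by omega)]
    obtain ⟨Q, hQ⟩ := Polynomial.powAddExpansion B L (k+1)
    rw [← hB, ← hL, hQ, Polynomial.coeff_add, Polynomial.coeff_add, hL, sq_coeff_zero, ← hL]
    have : ((k+1 : ℕ) : Polynomial ℝ) * B^(k+1-1) * L = Polynomial.C ((k:ℝ)+1) * (B^k * L) := by
      simp; ring
    rw [this, Polynomial.coeff_C_mul]; ring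
  have h1 : (B^(k+1)).coeff m * x^m ≤ E := by
    have := sum_coeff_le_eval (B^(k+1)) (polB_pow_nonneg _ _ _) x hx0.le {m}
    rw [Finset.sum_singleton, Polynomial.eval_pow] at this
    linarith
  have h2 : (B^k * L).coeff m * x^m ≤ E * (m.factorial * x^m) := by
    rw [Polynomial.coeff_mul, Finset.Nat.sum_antidiagonal_eq_sum_range_succ_mk, Finset.sum_mul]
    calc _ ≤ ∑ i ∈ Finset.range (m+1), ((B^k).coeff i * x^i) * (m.factorial * x^m) := by
          apply Finset.sum_le_sum
          intro i hi
          have hi' : i ≤ m := by have := Finset.mem_range.mp hi; omega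
          have hc : 0 ≤ (B^k).coeff i := polB_pow_nonneg _ _ _ _
          simp only [hL, polB_coeff]
          split_ifs with h
          · have := fact_mul_pow_le m (m-i) h.1 (by omega)
            rw [← hx] at this
            have e : x^m = x^i * x^(m-i) := by rw [← pow_add]; congr 1; omega
            calc (B^k).coeff i * ((m-i).factorial : ℝ) * x^m
                = (B^k).coeff i * x^i * (((m-i).factorial : ℝ) * x^(m-i)) := by rw [e]; ring
              _ ≤ _ := by gcongr
          · simp only [mul_zero, zero_mul]; positivity
      _ = (∑ i ∈ Finset.range (m+1), ((B^k).coeff i * x^i)) * (m.factorial * x^m) := by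
          rw [Finset.sum_mul]
      _ ≤ E * (m.factorial * x^m) := by
          gcongr
          have := sum_coeff_le_eval (B^k) (polB_pow_nonneg _ _ _) x hx0.le (Finset.range (m+1))
          rw [Polynomial.eval_pow] at this
          linarith
  have h3 := one_le_fact m hm
  rw [← hx] at h3
  set q := (Real.exp 1 / 3)^m with hq
  have hq0 : 0 < q := by positivity
  have hxm : 0 < x^m := by positivity
  refine le_of_mul_le_mul_right ?_ hxm
  rw [hG]
  set F := (m.factorial : ℝ) * x^m with hF
  have hF0 : 0 < F := by positivity
  have hk : (0:ℝ) ≤ k := by positivity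
  calc _ = (B^(k+1)).coeff m * x^m + (k+1) * ((B^k * L).coeff m * x^m) := by ring
    _ ≤ E * (F * q) + (k+1) * (E * F) :=
      add_le_add (h1.trans (le_mul_of_one_le_right hE0.le h3))
        (mul_le_mul_of_nonneg_left h2 (by linarith))
    _ ≤ (k+1) * (E * (F * q)) + (k+1) * (E * F) := by
      have : 0 ≤ k * (E * (F * q)) := by positivity
      linarith
    _ = _ := by rw [hF]; ring

theorem main_of_G (K : ℕ → ℕ)
    (hK : Tendsto (fun n : ℕ => (K n : ℝ) / n) atTop (nhds 0)) (ε : ℝ) (hε : 0 < ε) :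
    ∃ N : ℕ, ∀ n ≥ N, ∀ k : ℕ, k ≤ K n →
      k ≤ n ∧ G k (n-k) ≤ (1 + ε) * (k + 1) * (n - k).factorial := by
  have t1 : Tendsto (fun n : ℕ => (1:ℝ)/n) atTop (nhds 0) := tendsto_one_div_atTop_nhds_zero_nat
  have hq1 : Real.exp 1 / 3 < 1 := by have := Real.exp_one_lt_d9; linarith
  have t2 : Tendsto (fun n : ℕ => (Real.exp 1 / 3)^(n/2)) atTop (nhds 0) :=
    (tendsto_pow_atTop_nhds_zero_of_lt_one (by positivity) hq1).comp
      (Nat.tendsto_div_const_atTop (by norm_num))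
  have t3 : Tendsto (fun n : ℕ => Real.exp (120 * ((K n : ℝ)/n + 1/n)) *
      (1 + (Real.exp 1 / 3)^(n/2))) atTop (nhds 1) := by
    have := ((Real.continuous_exp.tendsto _).comp ((hK.add t1).const_mul 120)).mul (t2.const_add 1)
    simpa using this
  have e1 := t3.eventually (gt_mem_nhds (show (1:ℝ) < 1 + ε by linarith))
  have e2 := hK.eventually (gt_mem_nhds (show (0:ℝ) < 1/2 by norm_num))
  obtain ⟨N, hN⟩ := eventually_atTop.mp (e1.and (e2.and (eventually_ge_atTop 2)))
  refine ⟨N, fun n hn k hk => ?_⟩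
  obtain ⟨a1, a2, a3⟩ := hN n hn
  have hn0 : (0:ℝ) < n := by exact_mod_cast (by omega : 0 < n)
  rw [div_lt_iff₀ hn0] at a2
  have hKn : 2 * K n ≤ n := by
    have : (2 * K n : ℝ) ≤ n := by linarith
    exact_mod_cast this
  have hkn : k ≤ n := by omega
  refine ⟨hkn, (G_le k (n-k) (by omega)).trans ?_⟩
  gcongr
  refine le_trans ?_ a1.le
  have hm2 : (n:ℝ) ≤ 2 * ((n-k : ℕ):ℝ) := by exact_mod_cast (by omega : n ≤ 2 * (n-k))
  gcongr ?_ * (1 + ?_)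
  · apply Real.exp_le_exp.mpr
    have hkK : (k:ℝ) ≤ K n := by exact_mod_cast hk
    rw [← add_div, mul_div_assoc', div_le_div_iff₀ (by linarith) hn0]
    have : ((k:ℝ)+1) * n ≤ ((K n:ℝ)+1) * (2 * ((n-k : ℕ):ℝ)) := by gcongr
    nlinarith
  · exact pow_le_pow_of_le_one (by positivity) hq1.le (by omega)

end


theorem image_eq_iff {n : ℕ} (σ : Equiv.Perm (Fin n)) (i : Fin n) :
    sharedEdge σ i ↔ (∀ a < i, σ a < i) ∧ σ i = i := by
  unfold sharedEdge
  refine and_congr_left fun _ => ?_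
  constructor
  · intro h a ha
    have : σ a ∈ (Finset.univ.filter (fun j => j < i)).image σ :=
      Finset.mem_image_of_mem _ (by simpa using ha)
    rw [h] at this
    simpa using this
  · intro h
    apply Finset.eq_of_subset_of_card_le
    · intro b hb
      simp only [Finset.mem_image, Finset.mem_filter, Finset.mem_univ, true_and] at hb ⊢
      obtain ⟨a, ha, rfl⟩ := hb
      exact h a ha
    · rw [Finset.card_image_of_injective _ σ.injective]

open Classical in
noncomputable def restrLow {n : ℕ} (i : Fin n) (σ : Equiv.Perm (Fin n)) : Equiv.Perm (Fin i) :=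
  if h : ∀ a < i, σ a < i then
    Equiv.ofBijective (fun a : Fin i => (⟨σ (a.castLE i.2.le), h _ a.2⟩ : Fin i))
      (Finite.injective_iff_bijective.mp (by
        intro a b hab
        simp only [Fin.mk.injEq] at hab
        have := σ.injective (Fin.ext hab)
        exact Fin.castLE_injective _ this))
  else 1

theorem restrLow_apply {n : ℕ} (i : Fin n) (σ : Equiv.Perm (Fin n)) (h : ∀ a < i, σ a < i)
    (a : Fin i) : ((restrLow i σ a : Fin i) : ℕ) = σ (a.castLE i.2.le) := by
  simp [restrLow, dif_pos h]

theorem above_of {n : ℕ} (i : Fin n) (σ : Equiv.Perm (Fin n)) (h : sharedEdge σ i) :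
    ∀ a, i < σ a ↔ i < a := by
  have hs := (image_eq_iff σ i).mp h
  intro a
  constructor
  · intro ha
    by_contra hc
    rcases lt_or_eq_of_le (not_lt.mp hc) with h1 | h1
    · exact absurd (hs.1 a h1) (not_lt.mpr ha.le)
    · rw [h1, hs.2] at ha; exact lt_irrefl _ ha
  · intro ha
    by_contra hc
    rcases lt_or_eq_of_le (not_lt.mp hc) with h1 | h1
    · have h2 := h.1
      have : σ a ∈ Finset.univ.filter (fun j => j < i) := by simpa using h1
      rw [← h2, Finset.mem_image] at this
      obtain ⟨b, hb, hba⟩ := this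
      have := σ.injective hba
      subst this
      simp at hb
      exact absurd hb (not_lt.mpr ha.le)
    · have := σ.injective (h1.trans hs.2.symm)
      exact absurd ha (by rw [this]; exact lt_irrefl _)

open Classical in
noncomputable def restrHigh {n : ℕ} (i : Fin n) (σ : Equiv.Perm (Fin n)) :
    Equiv.Perm {x : Fin n // i < x} :=
  if h : ∀ a, i < σ a ↔ i < a then σ.subtypePerm h else 1

theorem restrHigh_apply {n : ℕ} (i : Fin n) (σ : Equiv.Perm (Fin n)) (h : ∀ a, i < σ a ↔ i < a)
    (a : {x : Fin n // i < x}) : (restrHigh i σ a : Fin n) = σ a := by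
  simp [restrHigh, dif_pos h]

theorem shared_restr {n : ℕ} (i : Fin n) (σ : Equiv.Perm (Fin n)) (h : sharedEdge σ i)
    (j : Fin i) : sharedEdge (restrLow i σ) j ↔ sharedEdge σ (j.castLE i.2.le) := by
  have hs := ((image_eq_iff σ i).mp h).1
  rw [image_eq_iff, image_eq_iff]
  simp only [Fin.lt_def, Fin.ext_iff, restrLow_apply i σ hs, Fin.val_castLE]
  refine and_congr_left fun _ => ?_
  constructor
  · intro H a ha
    exact H ⟨a, ha.trans j.2⟩ ha
  · intro H a ha
    exact H _ ha

theorem kShared_restr {n : ℕ} (i : Fin n) (σ : Equiv.Perm (Fin n)) (h : sharedEdge σ i)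
    (hl : ∀ j, sharedEdge σ j → j ≤ i) : kShared σ = kShared (restrLow i σ) + 1 := by
  classical
  unfold kShared
  have : (Finset.univ.filter (fun j => sharedEdge σ j)) =
      insert i ((Finset.univ.filter (fun j => sharedEdge (restrLow i σ) j)).map
        (Fin.castLEEmb i.2.le)) := by
    ext j
    simp only [Finset.mem_filter, Finset.mem_univ, true_and, Finset.mem_insert, Finset.mem_map,
      shared_restr i σ h, Fin.castLEEmb_apply]
    constructor
    · intro hj
      rcases lt_or_eq_of_le (hl j hj) with h1 | h1
      · right
        exact ⟨⟨j, h1⟩, hj, rfl⟩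
      · exact Or.inl h1
    · rintro (rfl | ⟨a, ha, rfl⟩)
      · exact h
      · exact ha
  rw [this, Finset.card_insert_of_notMem, Finset.card_map]
  simp only [Finset.mem_map, not_exists, not_and, Fin.castLEEmb_apply]
  intro a _ ha
  have := congrArg Fin.val ha
  simp at this
  have := a.2
  omega

theorem fCount_rec (n k : ℕ) :
    fCount n (k+1) ≤ ∑ i : Fin n, fCount i k * (n - 1 - i).factorial := by
  classical
  unfold fCount
  have hsub : (Finset.univ.filter (fun σ : Equiv.Perm (Fin n) => kShared σ = k+1)) ⊆
      Finset.univ.biUnion (fun i : Fin n => Finset.univ.filter (fun σ : Equiv.Perm (Fin n) =>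
        kShared σ = k+1 ∧ sharedEdge σ i ∧ ∀ j, sharedEdge σ j → j ≤ i)) := by
    intro σ hσ
    simp only [Finset.mem_filter, Finset.mem_univ, true_and, Finset.mem_biUnion] at hσ ⊢
    have hne : (Finset.univ.filter (fun j => sharedEdge σ j)).Nonempty := by
      rw [← Finset.card_pos]
      unfold kShared at hσ
      omega
    refine ⟨(Finset.univ.filter (fun j => sharedEdge σ j)).max' hne, hσ, ?_, ?_⟩
    · have := Finset.max'_mem _ hne
      exact (Finset.mem_filter.mp this).2
    · intro j hj
      exact Finset.le_max' _ _ (by simpa using hj)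
  refine (Finset.card_le_card hsub).trans (Finset.card_biUnion_le.trans ?_)
  refine Finset.sum_le_sum fun i _ => ?_
  have hc : (n - 1 - i).factorial =
      (Finset.univ : Finset (Equiv.Perm {x : Fin n // i < x})).card := by
    rw [Finset.card_univ, Fintype.card_perm]
    congr 1
    rw [Fintype.card_subtype]
    have : (Finset.univ.filter (fun x => i < x)) = Finset.Ioi i := by ext; simp
    rw [this, Fin.card_Ioi]
  rw [hc, ← Finset.card_product]
  refine Finset.card_le_card_of_injOn (fun σ => (restrLow i σ, restrHigh i σ)) ?_ ?_
  · intro σ hσ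
    simp only [Finset.coe_filter, Finset.mem_univ, true_and, Set.mem_ofPred_eq] at hσ
    simp only [Finset.coe_product, Finset.coe_filter, Set.mem_prod, Finset.mem_univ, true_and,
      Set.mem_ofPred_eq, Finset.coe_univ, Set.mem_univ, and_true]
    have := kShared_restr i σ hσ.2.1 hσ.2.2
    omega
  · intro σ hσ τ hτ hst
    simp only [Finset.coe_filter, Finset.mem_univ, true_and, Set.mem_ofPred_eq] at hσ hτ
    simp only [Prod.mk.injEq] at hst
    have s1 := (image_eq_iff σ i).mp hσ.2.1
    have s2 := (image_eq_iff τ i).mp hτ.2.1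
    ext a
    rcases lt_trichotomy a i with h | h | h
    · have e1 := restrLow_apply i σ s1.1 ⟨a, h⟩
      have e2 := restrLow_apply i τ s2.1 ⟨a, h⟩
      rw [hst.1] at e1
      exact e1.symm.trans e2
    · rw [h, s1.2, s2.2]
    · have e1 := restrHigh_apply i σ (above_of i σ hσ.2.1) ⟨a, h⟩
      have e2 := restrHigh_apply i τ (above_of i τ hτ.2.1) ⟨a, h⟩
      rw [hst.2] at e1
      exact congrArg Fin.val (e1.symm.trans e2)

theorem fCount_zero_of_lt (n k : ℕ) (h : n < k) : fCount n k = 0 := by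
  unfold fCount
  rw [Finset.card_eq_zero, Finset.filter_eq_empty_iff]
  intro σ _ hσ
  have : kShared σ ≤ n := by
    unfold kShared
    exact (Finset.card_le_univ _).trans (by simp)
  omega

theorem fCount_le_G (k n : ℕ) (h : k ≤ n) : (fCount n k : ℝ) ≤ G k (n-k) := by
  induction k generalizing n with
  | zero =>
    simp only [G, Nat.sub_zero]
    norm_cast
    unfold fCount
    refine (Finset.card_le_univ (α := Equiv.Perm (Fin n)) _).trans ?_
    rw [Fintype.card_perm, Fintype.card_fin]
  | succ k ih =>
    have h1 : (fCount n (k+1) : ℝ) ≤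
        ∑ i ∈ Finset.range n, (fCount i k : ℝ) * (n-1-i).factorial := by
      rw [← Fin.sum_univ_eq_sum_range (fun i => (fCount i k : ℝ) * ((n-1-i).factorial : ℝ))]
      exact_mod_cast fCount_rec n k
    refine h1.trans ?_
    simp only [G]
    rw [Finset.Nat.sum_antidiagonal_eq_sum_range_succ_mk]
    have hn : n = k + (n-(k+1)+1) := by omega
    generalize n - (k+1) = d at hn
    subst hn
    rw [Finset.sum_range_add, Finset.sum_eq_zero, zero_add]
    · refine Finset.sum_le_sum fun j hj => ?_
      have := ih (k+j) (by omega)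
      rw [Nat.add_sub_cancel_left] at this
      have e : k + (d+1) - 1 - (k+j) = d - j := by omega
      rw [e]
      gcongr
    · intro i hi
      rw [fCount_zero_of_lt i k (Finset.mem_range.mp hi)]
      simp

/-- Path counting, small overlap: if `K(n) = o(n)`, then uniformly in `1 ≤ k ≤ K(n)`,
`f(n,k) ≤ (1 + o(1)) (k+1) (n-k)!`. -/
theorem path_counting_small_overlap (K : ℕ → ℕ)
    (hK : Tendsto (fun n : ℕ => (K n : ℝ) / n) atTop (nhds 0)) :
    ∀ ε > (0 : ℝ), ∃ N : ℕ, ∀ n ≥ N, ∀ k : ℕ, 1 ≤ k → k ≤ K n →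
      (fCount n k : ℝ) ≤ (1 + ε) * (k + 1) * (n - k).factorial := by
  intro ε hε
  obtain ⟨N, hN⟩ := main_of_G K hK ε hε
  refine ⟨N, fun n hn k _ hk => ?_⟩
  obtain ⟨h1, h2⟩ := hN n hn k hk
  exact (fCount_le_G k n h1).trans h2
end

section
/- (Path counting, large overlap.) For a permutation σ of {1,…,n}, let k(σ) = #{ i ∈ {1,…,n} : σ({1,…,i−1}) = {1,…,i−1} and σ(i) = i }, and let f(n,k) = #{ σ : k(σ) = k }. There exists N such that for all n ≥ N and every k with n − 5e(n+3)^{2/3} ≤ k ≤ n: f(n,k) ≤ (2 n^{7/8})^{n−k} · (n − k + 1). -/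
open Filter

lemma sharedEdge_iff_aux {n : ℕ} (σ : Equiv.Perm (Fin n)) (i : Fin n) :
    sharedEdge σ i ↔ (∀ j : Fin n, j < i → σ j < i) ∧ σ i = i := by
  unfold sharedEdge
  refine and_congr_left fun _ => ?_
  constructor
  · intro h j hj
    have : σ j ∈ (Finset.univ.filter (fun j => j < i)).image σ :=
      Finset.mem_image_of_mem _ (by simpa using hj)
    rw [h] at this
    simpa using this
  · intro h
    apply Finset.eq_of_subset_of_card_le
    · intro x hx
      obtain ⟨j, hj, rfl⟩ := Finset.mem_image.1 hx
      simpa using h j (by simpa using hj)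
    · rw [Finset.card_image_of_injective _ σ.injective]

lemma invariant_iff_aux {n b : ℕ} (σ : Equiv.Perm (Fin n))
    (h : ∀ j : Fin n, j.val < b → (σ j).val < b) (x : Fin n) :
    (σ x).val < b ↔ x.val < b := by
  refine ⟨fun hx => ?_, h x⟩
  have himg : (Finset.univ.filter (fun j : Fin n => j.val < b)).image σ
      = Finset.univ.filter (fun j : Fin n => j.val < b) := by
    apply Finset.eq_of_subset_of_card_le
    · intro x hx
      obtain ⟨j, hj, rfl⟩ := Finset.mem_image.1 hx
      simpa using h j (by simpa using hj)
    · rw [Finset.card_image_of_injective _ σ.injective]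
  have : σ x ∈ (Finset.univ.filter (fun j : Fin n => j.val < b)).image σ := by
    rw [himg]; simpa using hx
  obtain ⟨j, hj, hjx⟩ := Finset.mem_image.1 this
  rw [← σ.injective hjx]
  simpa using hj

/-- Permutations fixing everything below `a`, with exactly `m` non-shared edges. -/
def suffixSet (n a m : ℕ) : Finset (Equiv.Perm (Fin n)) :=
  Finset.univ.filter (fun σ => (∀ i : Fin n, i.val < a → σ i = i) ∧ kShared σ + m = n)

lemma kShared_le_aux {n : ℕ} (σ : Equiv.Perm (Fin n)) : kShared σ ≤ n := by
  unfold kShared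
  exact (Finset.card_le_univ _).trans (by simp)

lemma suffix_decomp {n a m : ℕ} (ha : a < n) (σ : Equiv.Perm (Fin n))
    (hσ : σ ∈ suffixSet n a m) (hne : σ ⟨a, ha⟩ ≠ ⟨a, ha⟩) :
    ∃ j ∈ Finset.Icc 2 m,
      ∃ τ : Equiv.Perm {x : Fin n // a ≤ x.val ∧ x.val < a + j},
      ∃ ρ ∈ suffixSet n (a + j) (m - j), Equiv.Perm.ofSubtype τ * ρ = σ := by
  simp only [suffixSet, Finset.mem_filter, Finset.mem_univ, true_and] at hσ
  obtain ⟨hfix, hk⟩ := hσ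
  classical
  have hex : ∃ j, 1 ≤ j ∧ ∀ x : Fin n, x.val < a + j → (σ x).val < a + j :=
    ⟨n - a, by omega, fun x _ => by have := (σ x).isLt; omega⟩
  obtain ⟨hj1, hinv⟩ := Nat.find_spec hex
  have hmin : ∀ i, 1 ≤ i → i < Nat.find hex →
      ¬ ∀ x : Fin n, x.val < a + i → (σ x).val < a + i :=
    fun i hi hlt h => Nat.find_min hex hlt ⟨hi, h⟩
  have hjn : a + Nat.find hex ≤ n := by
    have : Nat.find hex ≤ n - a :=
      Nat.find_min' hex ⟨by omega, fun x _ => by have := (σ x).isLt; omega⟩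
    omega
  generalize Nat.find hex = j at *
  have hinvA : ∀ x : Fin n, (σ x).val < a ↔ x.val < a :=
    invariant_iff_aux σ (fun x hx => by rw [hfix x hx]; exact hx)
  have hinvB := invariant_iff_aux σ hinv
  have hj2 : 2 ≤ j := by
    by_contra hlt
    have : j = 1 := by omega
    subst this
    apply hne
    have h1 := hinv ⟨a, ha⟩ (by simp)
    have h2 := hinvA ⟨a, ha⟩
    apply Fin.ext
    simp only at h1 h2 ⊢
    omega
  have hp : ∀ x : Fin n, (a ≤ (σ x).val ∧ (σ x).val < a + j) ↔ (a ≤ x.val ∧ x.val < a + j) := by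
    intro x
    have := hinvA x; have := hinvB x
    omega
  have hq : ∀ x : Fin n, (a + j ≤ (σ x).val) ↔ (a + j ≤ x.val) := by
    intro x
    have := hinvB x
    omega
  set τ : Equiv.Perm {x : Fin n // a ≤ x.val ∧ x.val < a + j} := σ.subtypePerm hp with hτ
  set ρ : Equiv.Perm (Fin n) := Equiv.Perm.ofSubtype
    (p := fun x : Fin n => a + j ≤ x.val) (σ.subtypePerm hq) with hρ
  have hρ1 : ∀ x : Fin n, a + j ≤ x.val → ρ x = σ x := by
    intro x hx
    exact Equiv.Perm.ofSubtype_apply_of_mem (p := fun x : Fin n => a + j ≤ x.val)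
      (σ.subtypePerm hq) hx
  have hρ2 : ∀ x : Fin n, x.val < a + j → ρ x = x := by
    intro x hx
    rw [hρ, Equiv.Perm.ofSubtype_apply_of_not_mem _ (by omega)]
  have hτ1 : ∀ x : Fin n, a ≤ x.val ∧ x.val < a + j → Equiv.Perm.ofSubtype τ x = σ x := by
    intro x hx
    exact Equiv.Perm.ofSubtype_apply_of_mem
      (p := fun x : Fin n => a ≤ x.val ∧ x.val < a + j) (σ.subtypePerm hp) hx
  have hτ2 : ∀ x : Fin n, ¬ (a ≤ x.val ∧ x.val < a + j) → Equiv.Perm.ofSubtype τ x = x := by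
    intro x hx
    exact Equiv.Perm.ofSubtype_apply_of_not_mem
      (p := fun x : Fin n => a ≤ x.val ∧ x.val < a + j) (σ.subtypePerm hp) hx
  -- shared edges
  have hsh : (Finset.univ.filter (fun i => sharedEdge ρ i)) =
      (Finset.univ.filter (fun i => sharedEdge σ i)) ∪
      (Finset.univ.filter (fun i : Fin n => a ≤ i.val ∧ i.val < a + j)) := by
    ext i
    simp only [Finset.mem_filter, Finset.mem_univ, true_and, Finset.mem_union,
      sharedEdge_iff_aux, Fin.lt_def]
    by_cases hi : i.val < a + j
    · have hL : (∀ x : Fin n, x.val < i.val → (ρ x).val < i.val) ∧ ρ i = i :=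
        ⟨fun x hx => by rw [hρ2 x (by omega)]; exact hx, hρ2 i hi⟩
      refine ⟨fun _ => ?_, fun _ => hL⟩
      by_cases hia : a ≤ i.val
      · exact Or.inr ⟨hia, hi⟩
      · exact Or.inl ⟨fun x hx => by rw [hfix x (by omega)]; exact hx, hfix i (by omega)⟩
    · rw [hρ1 i (by omega)]
      constructor
      · rintro ⟨h1, h2⟩
        refine Or.inl ⟨fun x hx => ?_, h2⟩
        by_cases hxb : x.val < a + j
        · have := hinv x hxb; omega
        · rw [← hρ1 x (by omega)]; exact h1 x hx
      · rintro (⟨h1, h2⟩ | h)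
        · refine ⟨fun x hx => ?_, h2⟩
          by_cases hxb : x.val < a + j
          · rw [hρ2 x hxb]; exact hx
          · rw [hρ1 x (by omega)]; exact h1 x hx
        · omega
  have hdisj : Disjoint (Finset.univ.filter (fun i => sharedEdge σ i))
      (Finset.univ.filter (fun i : Fin n => a ≤ i.val ∧ i.val < a + j)) := by
    rw [Finset.disjoint_left]
    intro i hi hi2
    simp only [Finset.mem_filter, Finset.mem_univ, true_and,
      sharedEdge_iff_aux, Fin.lt_def] at hi hi2
    obtain ⟨h1, h2⟩ := hi
    obtain ⟨h3, h4⟩ := hi2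
    rcases Nat.eq_or_lt_of_le h3 with h | h
    · apply hne
      have : (⟨a, ha⟩ : Fin n) = i := Fin.ext h
      rw [this, h2]
    · apply hmin (i.val - a) (by omega) (by omega)
      intro x hx
      have := h1 x (by omega)
      omega
  have hcard : (Finset.univ.filter (fun i : Fin n => a ≤ i.val ∧ i.val < a + j)).card = j := by
    rw [← Finset.card_map Fin.valEmbedding]
    have : (Finset.univ.filter (fun i : Fin n => a ≤ i.val ∧ i.val < a + j)).map Fin.valEmbedding
        = Finset.Ico a (a + j) := by
      ext x
      simp only [Finset.mem_map, Finset.mem_filter, Finset.mem_univ, true_and,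
        Fin.valEmbedding_apply, Finset.mem_Ico]
      constructor
      · rintro ⟨y, hy, rfl⟩; exact hy
      · intro hx; exact ⟨⟨x, by omega⟩, hx, rfl⟩
    rw [this]; simp
  have hkρ : kShared ρ = kShared σ + j := by
    unfold kShared
    rw [hsh, Finset.card_union_of_disjoint hdisj, hcard]
  have hle := kShared_le_aux ρ
  refine ⟨j, Finset.mem_Icc.2 ⟨hj2, by omega⟩, τ, ρ, ?_, ?_⟩
  · simp only [suffixSet, Finset.mem_filter, Finset.mem_univ, true_and]
    exact ⟨hρ2, by omega⟩
  · ext1 x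
    rw [Equiv.Perm.mul_apply]
    by_cases hx : x.val < a + j
    · rw [hρ2 x hx]
      by_cases hxa : a ≤ x.val
      · exact hτ1 x ⟨hxa, hx⟩
      · rw [hτ2 x (by omega), hfix x (by omega)]
    · rw [hρ1 x (by omega), hτ2]
      have := hinvB x
      omega

lemma suffix_rec {n a m : ℕ} (ha : a < n) :
    (suffixSet n a m).card ≤ (suffixSet n (a + 1) m).card +
      ∑ j ∈ Finset.Icc 2 m, j.factorial * (suffixSet n (a + j) (m - j)).card := by
  classical
  have hsub : suffixSet n a m ⊆ suffixSet n (a + 1) m ∪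
      (Finset.Icc 2 m).biUnion (fun j =>
        ((Finset.univ : Finset (Equiv.Perm {x : Fin n // a ≤ x.val ∧ x.val < a + j})) ×ˢ
          suffixSet n (a + j) (m - j)).image (fun p => Equiv.Perm.ofSubtype p.1 * p.2)) := by
    intro σ hσ
    by_cases h : σ ⟨a, ha⟩ = ⟨a, ha⟩
    · apply Finset.mem_union_left
      simp only [suffixSet, Finset.mem_filter, Finset.mem_univ, true_and] at hσ ⊢
      refine ⟨fun i hi => ?_, hσ.2⟩
      rcases Nat.lt_or_ge i.val a with h1 | h1
      · exact hσ.1 i h1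
      · have : i = ⟨a, ha⟩ := Fin.ext (by simp only; omega)
        rw [this, h]
    · apply Finset.mem_union_right
      obtain ⟨j, hj, τ, ρ, hρ, e⟩ := suffix_decomp ha σ hσ h
      refine Finset.mem_biUnion.2 ⟨j, hj, Finset.mem_image.2 ⟨(τ, ρ), ?_, e⟩⟩
      simpa using hρ
  refine (Finset.card_le_card hsub).trans ((Finset.card_union_le _ _).trans ?_)
  refine Nat.add_le_add_left (Finset.card_biUnion_le.trans (Finset.sum_le_sum fun j _ => ?_)) _
  refine Finset.card_image_le.trans ?_
  rw [Finset.card_product]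
  refine Nat.mul_le_mul_right _ ?_
  rw [Finset.card_univ, Fintype.card_perm]
  apply Nat.factorial_le
  have hinj : Function.Injective
      (fun x : {x : Fin n // a ≤ x.val ∧ x.val < a + j} => (⟨x.1.val - a, by omega⟩ : Fin j)) := by
    intro x y hxy
    simp only [Fin.mk.injEq] at hxy
    apply Subtype.ext; apply Fin.ext
    have := x.2; have := y.2
    omega
  simpa using Fintype.card_le_of_injective _ hinj

lemma factorial_bound_aux (M i : ℕ) (h : i + 2 ≤ M) : (i + 2).factorial ≤ 2 * M ^ i := by
  induction i with
  | zero => simp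
  | succ i ih =>
    rw [show i + 1 + 2 = (i + 2) + 1 from rfl, Nat.factorial_succ, pow_succ]
    have := ih (by omega)
    calc (i + 2 + 1) * (i + 2).factorial ≤ M * (2 * M ^ i) := Nat.mul_le_mul (by omega) this
      _ = 2 * (M ^ i * M) := by ring

lemma sum_bound_aux (A : ℝ) (M m : ℕ) (hA : 1 ≤ A) (hM : 2 * (M : ℝ) ≤ A) (hm : m ≤ M) :
    ∑ j ∈ Finset.Icc 2 m, (j.factorial : ℝ) * (A⁻¹) ^ j ≤ 4 / A ^ 2 := by
  have hA0 : 0 < A := by linarith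
  have h1 : ∀ j ∈ Finset.Icc 2 m, (j.factorial : ℝ) * (A⁻¹) ^ j ≤
      8 / A ^ 2 * (1 / 2) ^ j := by
    intro j hj
    obtain ⟨h2, h3⟩ := Finset.mem_Icc.1 hj
    obtain ⟨i, rfl⟩ := Nat.exists_eq_add_of_le' h2
    have hf : ((i + 2).factorial : ℝ) ≤ 2 * (M : ℝ) ^ i := by
      exact_mod_cast factorial_bound_aux M i (by omega)
    have hMA : (M : ℝ) * A⁻¹ ≤ 1 / 2 := by
      rw [← div_eq_mul_inv, div_le_iff₀ hA0]; linarith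
    calc ((i + 2).factorial : ℝ) * (A⁻¹) ^ (i + 2)
        ≤ (2 * (M : ℝ) ^ i) * (A⁻¹) ^ (i + 2) := by gcongr
      _ = 2 / A ^ 2 * ((M : ℝ) * A⁻¹) ^ i := by
          rw [mul_pow, pow_add]; field_simp
      _ ≤ 2 / A ^ 2 * (1 / 2) ^ i := by gcongr
      _ = 8 / A ^ 2 * (1 / 2) ^ (i + 2) := by rw [pow_add]; ring
  refine (Finset.sum_le_sum h1).trans ?_
  rw [← Finset.mul_sum]
  have h2 : ∀ m : ℕ, ∑ j ∈ Finset.Icc 2 m, ((1 : ℝ) / 2) ^ j ≤ 1 / 2 - if 2 ≤ m then (1 / 2) ^ m else 0 := by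
    intro m
    induction m with
    | zero => simp
    | succ m ih =>
      by_cases h : 2 ≤ m
      · rw [Finset.sum_Icc_succ_top (by omega), if_pos (by omega)]
        rw [if_pos h] at ih
        rw [pow_succ]; linarith
      · have : m = 0 ∨ m = 1 := by omega
        rcases this with rfl | rfl <;> norm_num
  have h3 : ∑ j ∈ Finset.Icc 2 m, ((1 : ℝ) / 2) ^ j ≤ 1 / 2 := by
    refine (h2 m).trans ?_
    split_ifs
    · have : (0 : ℝ) < (1 / 2) ^ m := by positivity
      linarith
    · simp
  calc 8 / A ^ 2 * ∑ j ∈ Finset.Icc 2 m, ((1 : ℝ) / 2) ^ j ≤ 8 / A ^ 2 * (1 / 2) := by gcongr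
    _ = 4 / A ^ 2 := by ring

lemma suffix_bound (n : ℕ) (A : ℝ) (M : ℕ) (hA : 1 ≤ A) (hM : 2 * (M : ℝ) ≤ A) :
    ∀ d a m : ℕ, n - a = d → m ≤ M →
      ((suffixSet n a m).card : ℝ) ≤ A ^ m * (1 + 4 / A ^ 2) ^ d := by
  have hA0 : 0 < A := by linarith
  have hδ : (1 : ℝ) ≤ 1 + 4 / A ^ 2 := by
    have : 0 < 4 / A ^ 2 := by positivity
    linarith
  intro d
  induction d using Nat.strong_induction_on with
  | _ d ih =>
  intro a m hd hm
  rcases Nat.lt_or_ge a n with ha | ha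
  · obtain ⟨d, rfl⟩ : ∃ d', d = d' + 1 := ⟨d - 1, by omega⟩
    have hrec := suffix_rec (m := m) ha
    have hrec' : ((suffixSet n a m).card : ℝ) ≤ (suffixSet n (a + 1) m).card +
      ∑ j ∈ Finset.Icc 2 m, (j.factorial : ℝ) * (suffixSet n (a + j) (m - j)).card := by
      exact_mod_cast hrec
    have h1 := ih d (by omega) (a + 1) m (by omega) hm
    have h2 : ∑ j ∈ Finset.Icc 2 m, (j.factorial : ℝ) * (suffixSet n (a + j) (m - j)).card
        ≤ ∑ j ∈ Finset.Icc 2 m, ((j.factorial : ℝ) * (A⁻¹) ^ j) * (A ^ m * (1 + 4 / A ^ 2) ^ d) := by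
      refine Finset.sum_le_sum fun j hj => ?_
      obtain ⟨hj2, hjm⟩ := Finset.mem_Icc.1 hj
      have h3 := ih (n - (a + j)) (by omega) (a + j) (m - j) rfl (by omega)
      have h4 : (1 + 4 / A ^ 2) ^ (n - (a + j)) ≤ (1 + 4 / A ^ 2) ^ d :=
        pow_le_pow_right₀ hδ (by omega)
      have h5 : A ^ (m - j) = (A⁻¹) ^ j * A ^ m := by
        rw [pow_sub₀ _ hA0.ne' hjm, inv_pow, mul_comm]
      rw [mul_assoc, ← mul_assoc (A⁻¹ ^ j), ← h5]
      gcongr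
      exact h3.trans (by gcongr)
    rw [← Finset.sum_mul] at h2
    have h6 := sum_bound_aux A M m hA hM hm
    have h7 : 0 ≤ A ^ m * (1 + 4 / A ^ 2) ^ d := by positivity
    have h8 := mul_le_mul_of_nonneg_right h6 h7
    calc ((suffixSet n a m).card : ℝ) ≤ A ^ m * (1 + 4 / A ^ 2) ^ d +
          4 / A ^ 2 * (A ^ m * (1 + 4 / A ^ 2) ^ d) := by linarith
      _ = _ := by rw [pow_succ]; ring
  · have hc : (suffixSet n a m).card ≤ 1 := by
      rw [Finset.card_le_one]
      intro σ hσ τ hτ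
      simp only [suffixSet, Finset.mem_filter, Finset.mem_univ, true_and] at hσ hτ
      ext1 x
      rw [hσ.1 x (by omega), hτ.1 x (by omega)]
    have hc' : ((suffixSet n a m).card : ℝ) ≤ 1 := by exact_mod_cast hc
    exact hc'.trans (one_le_mul_of_one_le_of_one_le (one_le_pow₀ hA) (one_le_pow₀ hδ))

lemma fCount_self_le (n : ℕ) : fCount n n ≤ 1 := by
  unfold fCount
  rw [Finset.card_le_one]
  have key : ∀ σ : Equiv.Perm (Fin n), kShared σ = n → ∀ x, σ x = x := by
    intro σ hσ x
    unfold kShared at hσ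
    have : (Finset.univ.filter (fun i => sharedEdge σ i)) = Finset.univ := by
      rw [← Finset.card_eq_iff_eq_univ, hσ]; simp
    have hx : x ∈ (Finset.univ.filter (fun i => sharedEdge σ i)) := by rw [this]; simp
    exact (Finset.mem_filter.1 hx).2.2
  intro σ hσ τ hτ
  simp only [Finset.mem_filter, Finset.mem_univ, true_and] at hσ hτ
  ext1 x
  rw [key σ hσ, key τ hτ]

lemma eventually_aux : ∃ N : ℕ, ∀ n ≥ N, 1 ≤ n ∧
    2 * (5 * Real.exp 1 * ((n : ℝ) + 3) ^ ((2 : ℝ) / 3)) ≤ (n : ℝ) ^ ((7 : ℝ) / 8) ∧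
    4 * (n : ℝ) ≤ ((n : ℝ) ^ ((7 : ℝ) / 8)) ^ 2 := by
  have h1 : Tendsto (fun n : ℕ => (n : ℝ) ^ ((5 : ℝ) / 24)) atTop atTop :=
    (tendsto_rpow_atTop (by norm_num)).comp tendsto_natCast_atTop_atTop
  have h2 : Tendsto (fun n : ℕ => (n : ℝ) ^ ((3 : ℝ) / 4)) atTop atTop :=
    (tendsto_rpow_atTop (by norm_num)).comp tendsto_natCast_atTop_atTop
  have := (h1.eventually_ge_atTop (40 * Real.exp 1)).and
    ((h2.eventually_ge_atTop 4).and (eventually_ge_atTop 1))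
  obtain ⟨N, hN⟩ := eventually_atTop.1 this
  refine ⟨N, fun n hn => ?_⟩
  obtain ⟨ha, hb, hc⟩ := hN n hn
  have hc' : (1 : ℝ) ≤ n := by exact_mod_cast hc
  have hn0 : (0 : ℝ) < n := by linarith
  refine ⟨hc, ?_, ?_⟩
  · have e1 : ((n : ℝ) + 3) ^ ((2 : ℝ) / 3) ≤ 4 * (n : ℝ) ^ ((2 : ℝ) / 3) := by
      calc ((n : ℝ) + 3) ^ ((2 : ℝ) / 3) ≤ (4 * n) ^ ((2 : ℝ) / 3) := by
            apply Real.rpow_le_rpow <;> first | positivity | linarith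
        _ = 4 ^ ((2 : ℝ) / 3) * (n : ℝ) ^ ((2 : ℝ) / 3) :=
            Real.mul_rpow (by norm_num) hn0.le
        _ ≤ 4 ^ (1 : ℝ) * (n : ℝ) ^ ((2 : ℝ) / 3) := by
            gcongr <;> norm_num
        _ = _ := by rw [Real.rpow_one]
    have e2 : (n : ℝ) ^ ((7 : ℝ) / 8) = (n : ℝ) ^ ((5 : ℝ) / 24) * (n : ℝ) ^ ((2 : ℝ) / 3) := by
      rw [← Real.rpow_add hn0]; norm_num
    rw [e2]
    calc 2 * (5 * Real.exp 1 * ((n : ℝ) + 3) ^ ((2 : ℝ) / 3))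
        ≤ 2 * (5 * Real.exp 1 * (4 * (n : ℝ) ^ ((2 : ℝ) / 3))) := by gcongr
      _ = (40 * Real.exp 1) * (n : ℝ) ^ ((2 : ℝ) / 3) := by ring
      _ ≤ _ := by gcongr
  · have e2 : ((n : ℝ) ^ ((7 : ℝ) / 8)) ^ 2 = (n : ℝ) ^ ((3 : ℝ) / 4) * n := by
      rw [← Real.rpow_natCast, ← Real.rpow_mul hn0.le]
      nth_rewrite 3 [← Real.rpow_one (n : ℝ)]
      rw [← Real.rpow_add hn0]; norm_num
    rw [e2]
    gcongr

/-- Path counting, large overlap: for large `n` and `n - 5e(n+3)^{2/3} ≤ k ≤ n`,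
`f(n,k) ≤ (2 n^{7/8})^{n-k} (n-k+1)`. -/
theorem path_counting_large_overlap :
    ∃ N : ℕ, ∀ n ≥ N, ∀ k : ℕ,
      (n : ℝ) - 5 * Real.exp 1 * ((n : ℝ) + 3) ^ ((2 : ℝ) / 3) ≤ (k : ℝ) → k ≤ n →
      (fCount n k : ℝ) ≤ (2 * (n : ℝ) ^ ((7 : ℝ) / 8)) ^ (n - k) * ((n : ℝ) - k + 1) := by
  obtain ⟨N, hN⟩ := eventually_aux
  refine ⟨N, fun n hn k hk hkn => ?_⟩
  obtain ⟨hn1, hA2, hA4⟩ := hN n hn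
  obtain ⟨m, rfl⟩ := Nat.exists_eq_add_of_le hkn
  rcases Nat.eq_zero_or_pos m with rfl | hm
  · have := fCount_self_le k
    simpa using this
  set n := k + m with hndef
  have hnm : n - k = m := by omega
  have hcast : (n : ℝ) - k = m := by rw [hndef]; push_cast; ring
  rw [hnm, hcast]
  set A : ℝ := (n : ℝ) ^ ((7 : ℝ) / 8) with hAdef
  have hn1' : (1 : ℝ) ≤ n := by exact_mod_cast hn1
  have hA1 : 1 ≤ A := Real.one_le_rpow hn1' (by norm_num)
  have hA0 : 0 < A := by linarith
  have hM : 2 * (m : ℝ) ≤ A := by linarith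
  have hb := suffix_bound n A m hA1 hM n 0 m (by simp) le_rfl
  have hf : fCount n k = (suffixSet n 0 m).card := by
    unfold fCount suffixSet
    congr 1
    ext σ
    simp only [Finset.mem_filter, Finset.mem_univ, true_and, Nat.not_lt_zero, false_imp_iff,
      implies_true]
    omega
  rw [hf]
  have he : (1 + 4 / A ^ 2) ^ n ≤ 4 := by
    calc (1 + 4 / A ^ 2) ^ n ≤ (Real.exp (4 / A ^ 2)) ^ n := by
          gcongr
          linarith [Real.add_one_le_exp (4 / A ^ 2)]
      _ = Real.exp (n * (4 / A ^ 2)) := by rw [← Real.exp_nat_mul]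
      _ ≤ Real.exp 1 := by
          apply Real.exp_le_exp.2
          rw [← mul_div_assoc, div_le_one (by positivity)]
          linarith
      _ ≤ 4 := by linarith [Real.exp_one_lt_d9]
  have h2m : (2 : ℝ) ≤ 2 ^ m := by
    calc (2 : ℝ) = 2 ^ 1 := by norm_num
      _ ≤ 2 ^ m := pow_le_pow_right₀ (by norm_num) hm
  have hm1 : (1 : ℝ) ≤ m := by exact_mod_cast hm
  have h4 : (4 : ℝ) ≤ 2 ^ m * ((m : ℝ) + 1) := by nlinarith
  calc ((suffixSet n 0 m).card : ℝ) ≤ A ^ m * (1 + 4 / A ^ 2) ^ n := hb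
    _ ≤ A ^ m * (2 ^ m * ((m : ℝ) + 1)) := by gcongr; exact he.trans h4
    _ = _ := by rw [mul_pow]; ring
end

section
/- Let n and r be integers with 1 ≤ r and 2r + 1 ≤ n. The number of permutations σ of {1,…,n} whose oriented hypercube path shares at least one edge with the identity path at some step i with r + 1 ≤ i ≤ n − r (i.e. there exists i ∈ {r+1,…,n−r} with σ({1,…,i−1}) = {1,…,i−1} and σ(i) = i) is at most n · r! · (n − r − 1)!. -/
open Filter

theorem fact_aux (r j k : ℕ) (h : r ≤ j) :
    (r + k).factorial * j.factorial ≤ r.factorial * (j + k).factorial := by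
  induction k with
  | zero => simp
  | succ k ih =>
    rw [← Nat.add_assoc, ← Nat.add_assoc, Nat.factorial_succ, Nat.factorial_succ]
    calc (r + k + 1) * (r + k).factorial * j.factorial
        = (r + k + 1) * ((r + k).factorial * j.factorial) := by ring
      _ ≤ (j + k + 1) * (r.factorial * (j + k).factorial) :=
        Nat.mul_le_mul (by omega) ih
      _ = _ := by ring

theorem sharedEdge_lt_iff {n : ℕ} {σ : Equiv.Perm (Fin n)} {i : Fin n} (h : sharedEdge σ i)
    (x : Fin n) : σ x < i ↔ x < i := by
  have key := fun y => Finset.ext_iff.mp h.1 y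
  simp only [Finset.mem_image, Finset.mem_filter, Finset.mem_univ, true_and] at key
  constructor
  · intro hx
    obtain ⟨a, ha, e⟩ := (key (σ x)).2 hx
    rwa [← σ.injective e]
  · intro hx
    exact (key (σ x)).1 ⟨x, hx, rfl⟩

theorem sharedEdge_gt_iff {n : ℕ} {σ : Equiv.Perm (Fin n)} {i : Fin n} (h : sharedEdge σ i)
    (x : Fin n) : i < σ x ↔ i < x := by
  have h1 := sharedEdge_lt_iff h x
  have h2 : σ x = i ↔ x = i := by
    constructor
    · intro e
      exact σ.injective (e.trans h.2.symm)
    · rintro rfl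
      exact h.2
  rw [← not_le, ← not_le, le_iff_lt_or_eq, le_iff_lt_or_eq, h1, h2]

theorem card_sharedEdge_le {n : ℕ} (i : Fin n) :
    (Finset.univ.filter (fun σ : Equiv.Perm (Fin n) => sharedEdge σ i)).card
      ≤ (i : ℕ).factorial * (n - 1 - i).factorial := by
  let f : {σ : Equiv.Perm (Fin n) // sharedEdge σ i} →
      Equiv.Perm {x : Fin n // x < i} × Equiv.Perm {x : Fin n // i < x} := fun σ =>
    (σ.1.subtypePerm (sharedEdge_lt_iff σ.2), σ.1.subtypePerm (sharedEdge_gt_iff σ.2))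
  have hf : Function.Injective f := by
    rintro ⟨σ, hσ⟩ ⟨τ, hτ⟩ e
    have e1 := congrArg Prod.fst e
    have e2 := congrArg Prod.snd e
    apply Subtype.ext
    apply Equiv.ext
    intro x
    rcases lt_trichotomy x i with hx | hx | hx
    · have := congrArg Subtype.val (Equiv.ext_iff.mp e1 ⟨x, hx⟩)
      simpa [f] using this
    · subst hx
      exact hσ.2.trans hτ.2.symm
    · have := congrArg Subtype.val (Equiv.ext_iff.mp e2 ⟨x, hx⟩)
      simpa [f] using this
  have hc := Fintype.card_le_of_injective f hf
  rw [Fintype.card_prod, Fintype.card_perm, Fintype.card_perm, Fintype.card_subtype,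
    Fintype.card_subtype, Fintype.card_subtype] at hc
  have c1 : (Finset.univ.filter (fun x : Fin n => x < i)).card = i := by
    rw [show Finset.univ.filter (fun x : Fin n => x < i) = Finset.Iio i by ext; simp, Fin.card_Iio]
  have c2 : (Finset.univ.filter (fun x : Fin n => i < x)).card = n - 1 - i := by
    rw [show Finset.univ.filter (fun x : Fin n => i < x) = Finset.Ioi i by ext; simp, Fin.card_Ioi]
  rwa [c1, c2] at hc

/-- The number of permutations whose path shares an edge with the identity path at some step
`i ∈ {r+1, …, n-r}` (1-based; 0-based: `r ≤ i < n - r`) is at most `n ⬝ r! ⬝ (n-r-1)!`. -/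
theorem count_paths_sharing_middle_edge (n r : ℕ) (hr : 1 ≤ r) (hn : 2 * r + 1 ≤ n) :
    (Finset.univ.filter (fun σ : Equiv.Perm (Fin n) =>
        ∃ i : Fin n, r ≤ (i : ℕ) ∧ (i : ℕ) < n - r ∧ sharedEdge σ i)).card
      ≤ n * r.factorial * (n - r - 1).factorial := by
  classical
  calc _ ≤ ((Finset.univ.filter (fun i : Fin n => r ≤ (i : ℕ) ∧ (i : ℕ) < n - r)).biUnion
        (fun i => Finset.univ.filter (fun σ : Equiv.Perm (Fin n) => sharedEdge σ i))).card := by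
        apply Finset.card_le_card
        intro σ hσ
        simp only [Finset.mem_filter, Finset.mem_univ, true_and, Finset.mem_biUnion] at hσ ⊢
        obtain ⟨i, h1, h2, h3⟩ := hσ
        exact ⟨i, ⟨h1, h2⟩, h3⟩
    _ ≤ (Finset.univ.filter (fun i : Fin n => r ≤ (i : ℕ) ∧ (i : ℕ) < n - r)).card *
        (r.factorial * (n - r - 1).factorial) := by
        apply Finset.card_biUnion_le_card_mul
        intro i hi
        simp only [Finset.mem_filter, Finset.mem_univ, true_and] at hi
        refine (card_sharedEdge_le i).trans ?_
        have h := fact_aux r (n - 1 - i) (i - r) (by omega)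
        rwa [show r + ((i : ℕ) - r) = i by omega,
          show n - 1 - (i : ℕ) + (i - r) = n - r - 1 by omega] at h
    _ ≤ n * (r.factorial * (n - r - 1).factorial) := by
        apply Nat.mul_le_mul_right
        exact (Finset.card_le_univ _).trans (by simp)
    _ = _ := by ring
end

section
/- Let n ≥ 1 and let 0 = u₀ < u₁ < … < u_k < u_{k+1} = n + 1 be integers. The number of permutations σ of {1,…,n} whose set of shared-edge steps with the identity path is exactly {u₁,…,u_k} (i.e. { i ∈ {1,…,n} : σ({1,…,i−1}) = {1,…,i−1} and σ(i) = i } = {u₁,…,u_k}) is at most ∏_{i=0}^{k} (u_{i+1} − u_i − 1)!. -/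
open Filter

lemma shared_lt_iff {n : ℕ} (σ : Equiv.Perm (Fin n)) (i : Fin n) (h : sharedEdge σ i)
    (x : Fin n) : σ x < i ↔ x < i := by
  have h1 := h.1
  constructor
  · intro hx
    have : σ x ∈ (Finset.univ.filter (fun j => j < i)).image σ := by
      rw [h1]; simpa using hx
    simpa using this
  · intro hx
    have : σ x ∈ (Finset.univ.filter (fun j => j < i)).image σ := by
      simpa using hx
    rw [h1] at this
    simpa using this

/-- Let `0 = u₀ < u₁ < … < u_k < u_{k+1} = n+1`. The number of permutations whose set of
shared-edge steps with the identity path (1-based) is exactly `{u₁, …, u_k}` is at most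
`∏_{i=0}^{k} (u_{i+1} - u_i - 1)!`. -/
theorem count_paths_with_given_shared_steps (n k : ℕ) (hn : 1 ≤ n)
    (u : Fin (k + 2) → ℕ) (hu0 : u 0 = 0) (hulast : u (Fin.last (k + 1)) = n + 1)
    (humono : StrictMono u) :
    (Finset.univ.filter (fun σ : Equiv.Perm (Fin n) =>
        (Finset.univ.filter (fun i : Fin n => sharedEdge σ i)).image (fun i : Fin n => (i : ℕ) + 1)
          = Finset.univ.image (fun j : Fin k => u j.succ.castSucc))).card
      ≤ ∏ i : Fin (k + 1), (u i.succ - u i.castSucc - 1).factorial := by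
  classical
  let B : Fin (k + 1) → Fin n → Prop := fun j x =>
    u j.castSucc < (x : ℕ) + 1 ∧ (x : ℕ) + 1 < u j.succ
  have key : ∀ σ : Equiv.Perm (Fin n),
      ((Finset.univ.filter (fun i : Fin n => sharedEdge σ i)).image (fun i : Fin n => (i : ℕ) + 1)
          = Finset.univ.image (fun j : Fin k => u j.succ.castSucc)) →
      ∀ (j : Fin (k + 2)) (x : Fin n), (((σ x : Fin n) : ℕ) + 1 < u j ↔ (x : ℕ) + 1 < u j) ∧
        ((x : ℕ) + 1 = u j ↔ ((σ x : Fin n) : ℕ) + 1 = u j) := by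
    intro σ hσ j x
    induction j using Fin.cases with
    | zero => simp [hu0]
    | succ j =>
      induction j using Fin.lastCases with
      | last =>
        have h1 := x.isLt
        have h2 := (σ x).isLt
        rw [Fin.succ_last, hulast]
        omega
      | cast j =>
        have hm : u j.succ.castSucc ∈ Finset.univ.image (fun j : Fin k => u j.succ.castSucc) :=
          Finset.mem_image_of_mem _ (Finset.mem_univ _)
        rw [← hσ] at hm
        obtain ⟨i, hi, hiu⟩ := Finset.mem_image.1 hm
        have hs : sharedEdge σ i := (Finset.mem_filter.1 hi).2
        rw [Fin.succ_castSucc, ← hiu]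
        have h1 := shared_lt_iff σ i hs x
        have h2 : σ x = i ↔ x = i := by
          conv_lhs => rw [← hs.2]
          exact σ.injective.eq_iff
        rw [Fin.lt_def, Fin.lt_def] at h1
        rw [Fin.ext_iff, Fin.ext_iff] at h2
        omega
  have keyB : ∀ σ : Equiv.Perm (Fin n),
      ((Finset.univ.filter (fun i : Fin n => sharedEdge σ i)).image (fun i : Fin n => (i : ℕ) + 1)
          = Finset.univ.image (fun j : Fin k => u j.succ.castSucc)) →
      ∀ (j : Fin (k + 1)) (x : Fin n), B j (σ x) ↔ B j x := by
    intro σ hσ j x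
    have h1 := key σ hσ j.castSucc x
    have h2 := key σ hσ j.succ x
    simp only [B]
    omega
  have cover : ∀ x : Fin n, (∀ j, ¬ B j x) → ∃ j, (x : ℕ) + 1 = u j := by
    intro x hx
    by_contra! hne
    have hall : ∀ j, u j < (x : ℕ) + 1 := by
      intro j
      induction j using Fin.induction with
      | zero => omega
      | succ j ih =>
        have h1 := hx j
        have h2 := hne j.succ
        simp only [B] at h1
        omega
    have := hall (Fin.last (k + 1))
    have := x.isLt
    omega
  have cardB : ∀ j, Fintype.card {x // B j x} ≤ u j.succ - u j.castSucc - 1 := by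
    intro j
    rw [← Nat.card_Ioo, ← Fintype.card_coe]
    refine Fintype.card_le_of_injective
      (fun x => ⟨(x.1 : ℕ) + 1, Finset.mem_Ioo.2 x.2⟩) ?_
    intro x y hxy
    have : (x.1 : ℕ) + 1 = (y.1 : ℕ) + 1 := congrArg Subtype.val hxy
    apply Subtype.ext
    apply Fin.ext
    omega
  calc _ = Fintype.card {σ : Equiv.Perm (Fin n) //
        (Finset.univ.filter (fun i : Fin n => sharedEdge σ i)).image (fun i : Fin n => (i : ℕ) + 1)
          = Finset.univ.image (fun j : Fin k => u j.succ.castSucc)} := by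
        rw [Fintype.card_subtype]
    _ ≤ Fintype.card (∀ j : Fin (k + 1), Equiv.Perm {x // B j x}) := by
        refine Fintype.card_le_of_injective
          (fun σ j => σ.1.subtypePerm (keyB σ.1 σ.2 j)) ?_
        intro σ τ hst
        apply Subtype.ext
        apply Equiv.ext
        intro x
        by_cases hx : ∃ j, B j x
        · obtain ⟨j, hj⟩ := hx
          have h1 := congrArg Subtype.val (Equiv.congr_fun (congrFun hst j) ⟨x, hj⟩)
          simpa using h1
        · push Not at hx
          obtain ⟨j, hj⟩ := cover x hx
          have h1 := (key σ.1 σ.2 j x).2.1 hj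
          have h2 := (key τ.1 τ.2 j x).2.1 hj
          apply Fin.ext
          omega
    _ = ∏ j : Fin (k + 1), (Fintype.card {x // B j x}).factorial := by
        rw [Fintype.card_pi]
        exact Finset.prod_congr rfl fun j _ => Fintype.card_perm
    _ ≤ _ := Finset.prod_le_prod' fun j _ => Nat.factorial_le (cardB j)
end

section
/- Let λ > 0 and let f : ℕ₀ → ℝ be bounded with Σ_{k=0}^∞ f(k) λ^k / k! = 0, and define g : ℕ₀ → ℝ by g(0) = 0 and g(n) = ((n−1)!/λ^n) · Σ_{k=0}^{n−1} f(k) λ^k / k! for n ≥ 1. Then for every n ≥ 1: |g(n)| ≤ (sup_{k∈ℕ₀} |f(k)|) · e^{λ} / n. -/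
noncomputable section

/-- The Stein solution `g` associated with `f` and `λ`: `g 0 = 0` and
`g n = ((n-1)!/λ^n) ∑_{k=0}^{n-1} f(k) λ^k / k!` for `n ≥ 1`. -/
def steinG (lam : ℝ) (f : ℕ → ℝ) : ℕ → ℝ
  | 0 => 0
  | (m + 1) => (m.factorial : ℝ) / lam ^ (m + 1)
      * ∑ k ∈ Finset.range (m + 1), f k * lam ^ k / k.factorial

/-- Bound on the Stein solution: `|g(n)| ≤ (sup_k |f(k)|) e^λ / n` for `n ≥ 1`. -/
theorem stein_solution_bound (lam : ℝ) (hlam : 0 < lam) (f : ℕ → ℝ)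
    (hbdd : ∃ C : ℝ, ∀ k, |f k| ≤ C)
    (hsum : ∑' k : ℕ, f k * lam ^ k / k.factorial = 0) :
    ∀ n : ℕ, 1 ≤ n → |steinG lam f n| ≤ (⨆ k : ℕ, |f k|) * Real.exp lam / n := by
  obtain ⟨C, hC⟩ := hbdd
  have hB : BddAbove (Set.range fun k => |f k|) := ⟨C, by rintro _ ⟨k, rfl⟩; exact hC k⟩
  set M := ⨆ k : ℕ, |f k| with hM
  have hfM : ∀ k, |f k| ≤ M := fun k => le_ciSup hB k
  have hM0 : 0 ≤ M := (abs_nonneg _).trans (hfM 0)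
  have hexp : HasSum (fun j : ℕ => lam ^ j / (j.factorial : ℝ)) (Real.exp lam) := by
    rw [Real.exp_eq_exp_ℝ]
    exact NormedSpace.expSeries_div_hasSum_exp lam
  have habs : ∀ k : ℕ, ‖f k * lam ^ k / (k.factorial : ℝ)‖
      ≤ M * (lam ^ k / (k.factorial : ℝ)) := by
    intro k
    have h0 : 0 ≤ lam ^ k / (k.factorial : ℝ) := by positivity
    rw [mul_div_assoc, norm_mul, Real.norm_eq_abs, Real.norm_eq_abs, abs_of_nonneg h0]
    exact mul_le_mul_of_nonneg_right (hfM k) h0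
  have hs : Summable (fun k : ℕ => f k * lam ^ k / (k.factorial : ℝ)) :=
    Summable.of_norm_bounded (hexp.summable.mul_left M) habs
  intro n hn
  obtain ⟨m, rfl⟩ : ∃ m, n = m + 1 := ⟨n - 1, by omega⟩
  have hsplit := hs.sum_add_tsum_nat_add (m + 1)
  rw [hsum] at hsplit
  have htail : ‖∑' j : ℕ, f (j + (m + 1)) * lam ^ (j + (m + 1)) / ((j + (m + 1)).factorial : ℝ)‖
      ≤ M * (lam ^ (m + 1) / ((m + 1).factorial : ℝ)) * Real.exp lam := by
    refine tsum_of_norm_bounded (hexp.mul_left _) fun j => (habs _).trans ?_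
    rw [mul_assoc]
    refine mul_le_mul_of_nonneg_left ?_ hM0
    have hf : (j.factorial : ℝ) * ((m + 1).factorial : ℝ) ≤ ((j + (m + 1)).factorial : ℝ) := by
      exact_mod_cast Nat.le_of_dvd (Nat.factorial_pos _) (Nat.factorial_mul_factorial_dvd_factorial_add j (m + 1))
    calc lam ^ (j + (m + 1)) / ((j + (m + 1)).factorial : ℝ)
        ≤ lam ^ (j + (m + 1)) / ((j.factorial : ℝ) * ((m + 1).factorial : ℝ)) := by
          gcongr
      _ = _ := by rw [pow_add]; field_simp
  have heq : ∑ k ∈ Finset.range (m + 1), f k * lam ^ k / (k.factorial : ℝ)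
      = -∑' j : ℕ, f (j + (m + 1)) * lam ^ (j + (m + 1)) / ((j + (m + 1)).factorial : ℝ) := by
    linarith
  have h0 : 0 ≤ (m.factorial : ℝ) / lam ^ (m + 1) := by positivity
  rw [steinG, heq, abs_mul, abs_neg, abs_of_nonneg h0]
  refine (mul_le_mul_of_nonneg_left htail h0).trans (le_of_eq ?_)
  rw [Nat.factorial_succ]
  push_cast
  have : (m.factorial : ℝ) ≠ 0 := by positivity
  field_simp

end
end

section
/- (Uniform Stein factor bound.) Let λ > 0 and A ⊆ ℕ₀. Define f_A : ℕ₀ → ℝ by f_A(n) = 1_{n∈A} − e^{−λ} Σ_{j∈A} λ^j/j!, and g_A : ℕ₀ → ℝ by g_A(0) = 0 and g_A(n) = ((n−1)!/λ^n) · Σ_{k=0}^{n−1} f_A(k) λ^k / k! for n ≥ 1. Then for every n ≥ 0: |g_A(n+1) − g_A(n)| ≤ 1. -/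
noncomputable section

/-- The centered indicator `f_A(n) = 1_{n ∈ A} - P(Poisson(λ) ∈ A)`. -/
def steinF (lam : ℝ) (A : Set ℕ) (n : ℕ) : ℝ :=
  A.indicator (fun _ => (1 : ℝ)) n
    - Real.exp (-lam) * ∑' j : ℕ, A.indicator (fun j => lam ^ j / j.factorial) j

lemma aux_alg (E Q a b S T S' T' p u v d : ℝ)
    (hE : 0 < E) (hQ : Q = E⁻¹ * (a + (b + d * p))) (hS' : S' = S + p) (hT : T = T' + p)
    (hES : E = S + T) (hp : 0 ≤ p) (hd0 : 0 ≤ d) (hd1 : d ≤ 1)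
    (ha0 : 0 ≤ a) (haS : a ≤ S) (hb0 : 0 ≤ b) (hbT : b ≤ T')
    (hu : 0 ≤ u) (hv : 0 ≤ v)
    (h1 : u * T' ≤ v * T) (h2 : v * S ≤ u * S') (hfin : u * p * T' + v * p * S ≤ E) :
    |u * (a + d * p - Q * S') - v * (a - Q * S)| ≤ 1 := by
  have hQE : E * Q = a + (b + d * p) := by rw [hQ]; field_simp
  have key : E * (u * (a + d * p - Q * S') - v * (a - Q * S)) =
      a * (u * T' - v * T) - b * (u * S' - v * S) + d * (u * p * T' + v * p * S) := by
    have : E * (u * (a + d * p - Q * S') - v * (a - Q * S)) =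
      u * (E * (a + d * p) - (E * Q) * S') - v * (E * a - (E * Q) * S) := by ring
    rw [this, hQE, hES, hT, hS']; ring
  have hT'0 : 0 ≤ T' := hb0.trans hbT
  have hS0 : 0 ≤ S := ha0.trans haS
  have hW : 0 ≤ u * p * T' + v * p * S := by positivity
  have A1 : a * (v * T - u * T') ≤ S * (v * T - u * T') :=
    mul_le_mul_of_nonneg_right haS (by linarith)
  have A0 : 0 ≤ a * (v * T - u * T') := mul_nonneg ha0 (by linarith)
  have B1 : b * (u * S' - v * S) ≤ T' * (u * S' - v * S) :=
    mul_le_mul_of_nonneg_right hbT (by linarith)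
  have B0 : 0 ≤ b * (u * S' - v * S) := mul_nonneg hb0 (by linarith)
  have D0 : 0 ≤ d * (u * p * T' + v * p * S) := mul_nonneg hd0 hW
  have D1 : d * (u * p * T' + v * p * S) ≤ u * p * T' + v * p * S :=
    mul_le_of_le_one_left hW hd1
  have id1 : S * (v * T - u * T') + T' * (u * S' - v * S) = u * p * T' + v * p * S := by
    rw [hT, hS']; ring
  rw [abs_le]
  constructor
  · refine le_of_mul_le_mul_left ?_ hE
    rw [key]; linarith
  · refine le_of_mul_le_mul_left ?_ hE
    rw [key]; linarith

/-- Uniform Stein factor bound: `|g_A(n+1) - g_A(n)| ≤ 1` for all `n`. -/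
theorem stein_factor_bound (lam : ℝ) (hlam : 0 < lam) (A : Set ℕ) :
    ∀ n : ℕ, |steinG lam (steinF lam A) (n + 1) - steinG lam (steinF lam A) n| ≤ 1 := by
  intro n
  let p : ℕ → ℝ := fun k => lam ^ k / k.factorial
  let q : ℕ → ℝ := A.indicator p
  have hp : ∀ k, 0 < p k := fun k => by positivity
  have hq0 : ∀ k, 0 ≤ q k := fun k => Set.indicator_nonneg (fun x _ => (hp x).le) k
  have hqp : ∀ k, q k ≤ p k := fun k => Set.indicator_le_self' (fun x _ => (hp x).le) k
  have hps : Summable p := Real.summable_pow_div_factorial lam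
  have hqs : Summable q := hps.indicator A
  have hpE : ∑' k, p k = Real.exp lam := by
    rw [Real.exp_eq_exp_ℝ, NormedSpace.exp_eq_tsum_div]
  have hrec : ∀ k : ℕ, ((k : ℝ) + 1) * p (k + 1) = lam * p k := fun k => by
    simp only [p, pow_succ, Nat.factorial_succ]; push_cast; field_simp
  let S : ℕ → ℝ := fun n => ∑ k ∈ Finset.range n, p k
  let a : ℕ → ℝ := fun n => ∑ k ∈ Finset.range n, q k
  let T : ℕ → ℝ := fun n => ∑' k, p (k + n)
  let b : ℕ → ℝ := fun n => ∑' k, q (k + n)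
  have hps' : ∀ n, Summable fun k => p (k + n) := fun n => (summable_nat_add_iff n).2 hps
  have hqs' : ∀ n, Summable fun k => q (k + n) := fun n => (summable_nat_add_iff n).2 hqs
  have hST : ∀ n, Real.exp lam = S n + T n := fun n => by
    rw [← hpE]; exact (hps.sum_add_tsum_nat_add n).symm
  have hab : ∀ n, ∑' k, q k = a n + b n := fun n => (hqs.sum_add_tsum_nat_add n).symm
  have hSs : ∀ n, S (n + 1) = S n + p n := fun n => Finset.sum_range_succ _ _
  have has : ∀ n, a (n + 1) = a n + q n := fun n => Finset.sum_range_succ _ _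
  have hTs : ∀ n, T n = T (n + 1) + p n := fun n => by
    have := hST n; have := hST (n + 1); have := hSs n; linarith
  have hbs : ∀ n, b n = b (n + 1) + q n := fun n => by
    have := hab n; have := hab (n + 1); have := has n; linarith
  have ha0 : ∀ n, 0 ≤ a n := fun n => Finset.sum_nonneg fun k _ => hq0 k
  have haS : ∀ n, a n ≤ S n := fun n => Finset.sum_le_sum fun k _ => hqp k
  have hb0 : ∀ n, 0 ≤ b n := fun n => tsum_nonneg fun k => hq0 _
  have hbT : ∀ n, b n ≤ T n := fun n => (hqs' n).tsum_le_tsum (fun k => hqp _) (hps' n)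
  have hTT : ∀ n : ℕ, (n : ℝ) * T (n + 1) ≤ lam * T n := fun n => by
    simp only [T]
    rw [← tsum_mul_left, ← tsum_mul_left]
    refine ((hps' (n+1)).mul_left _).tsum_le_tsum (fun k => ?_) ((hps' n).mul_left _)
    have h := hrec (k + n)
    have h2 := hp (k + n + 1)
    rw [← h, ← add_assoc]
    refine mul_le_mul_of_nonneg_right ?_ h2.le
    push_cast
    have : (0 : ℝ) ≤ k := by positivity
    linarith
  have hSS : ∀ n : ℕ, lam * S n ≤ (n : ℝ) * S (n + 1) := fun n => by
    simp only [S]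
    rw [Finset.sum_range_succ', mul_add, Finset.mul_sum, Finset.mul_sum]
    have h0 : 0 ≤ (n : ℝ) * p 0 := mul_nonneg (by positivity) (hp 0).le
    refine le_add_of_le_of_nonneg (Finset.sum_le_sum fun k hk => ?_) h0
    rw [← hrec k]
    refine mul_le_mul_of_nonneg_right ?_ (hp _).le
    exact_mod_cast Finset.mem_range.1 hk
  obtain ⟨Q, hQ⟩ : ∃ Q, Q = (Real.exp lam)⁻¹ * ∑' k, q k := ⟨_, rfl⟩
  obtain ⟨d, hd0, hd1, hd⟩ : ∃ d : ℝ, 0 ≤ d ∧ d ≤ 1 ∧ q n = d * p n := by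
    by_cases h : n ∈ A
    · exact ⟨1, by simp, le_rfl, by simp [q, h]⟩
    · exact ⟨0, le_rfl, by simp, by simp [q, h]⟩
  have hg : ∀ m, steinG lam (steinF lam A) (m + 1) =
      (m.factorial : ℝ) / lam ^ (m + 1) * (a (m + 1) - Q * S (m + 1)) := fun m => by
    simp only [steinG]
    congr 1
    simp only [a, S]
    rw [Finset.mul_sum, ← Finset.sum_sub_distrib]
    refine Finset.sum_congr rfl fun k _ => ?_
    have : steinF lam A k = A.indicator (fun _ => (1 : ℝ)) k - Q := by
      rw [hQ, ← Real.exp_neg]; rfl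
    rw [this]
    by_cases h : k ∈ A <;> simp [q, p, h] <;> ring
  have hu : (n.factorial : ℝ) / lam ^ (n + 1) * p n = 1 / lam := by
    simp only [p]; field_simp; ring
  obtain ⟨v, hv0, hv, hgv, hvu⟩ : ∃ v : ℝ, 0 ≤ v ∧ (n ≠ 0 → v * p n = 1 / n) ∧
      steinG lam (steinF lam A) n = v * (a n - Q * S n) ∧
      (n ≠ 0 → v * n = (n.factorial : ℝ) / lam ^ (n + 1) * lam) := by
    cases n with
    | zero =>
      -- here `a 0 = S 0 = 0`; take a large enough factor
      exact ⟨(Real.exp lam) / lam, by positivity, by simp, by simp [steinG, a, S], by simp⟩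
    | succ m =>
      refine ⟨_, ?_, ?_, hg m, ?_⟩
      · positivity
      · intro _
        simp only [p, Nat.factorial_succ]; push_cast; field_simp
      · intro _
        simp only [Nat.factorial_succ]; push_cast; field_simp; ring
  rw [hg n, hgv, has, hd]
  have hT0 : ∀ m, 0 ≤ T m := fun m => (hb0 m).trans (hbT m)
  have hu0 : 0 ≤ (n.factorial : ℝ) / lam ^ (n + 1) := by positivity
  have hQ' : Q = (Real.exp lam)⁻¹ * (a n + (b (n + 1) + d * p n)) := by
    rw [hQ, hab n, hbs n, hd]
  rcases Nat.eq_zero_or_pos n with h0 | hn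
  · subst h0
    have hS0 : S 0 = 0 := by simp [S]
    have hp0 : p 0 = 1 := by simp [p]
    have hT1 : T (0 + 1) = Real.exp lam - 1 := by
      have := hST 0; have := hTs 0; linarith
    have hle : Real.exp lam - 1 ≤ lam * Real.exp lam := by
      have h1 := Real.add_one_le_exp (-lam)
      have h2 : Real.exp (-lam) * Real.exp lam = 1 := by rw [← Real.exp_add]; simp
      have h3 := mul_le_mul_of_nonneg_right h1 (Real.exp_pos lam).le
      linarith
    have ha : a 0 = 0 := by simp [a]
    have := aux_alg (Real.exp lam) Q (a 0) (b (0+1)) (S 0) (T 0) (S (0+1)) (T (0+1)) (p 0)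
      ((Nat.factorial 0 : ℝ) / lam ^ (0 + 1)) (1 / lam) d (Real.exp_pos _) hQ' (hSs 0) (hTs 0) (hST 0)
      (hp 0).le hd0 hd1 (ha0 0) (haS 0) (hb0 _) (hbT _) hu0 (by positivity)
      (by
        have := hTs 0
        simp only [Nat.factorial_zero, Nat.cast_one, zero_add, pow_one] at this ⊢
        refine mul_le_mul_of_nonneg_left ?_ (by positivity)
        linarith [hp 0])
      (by rw [hS0, hSs, hS0, hp0]; simp; exact hlam.le)
      (by rw [hu, hS0, hT1, mul_zero, add_zero, one_div, inv_mul_le_iff₀ hlam]; exact hle)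
    rw [ha, hS0] at this ⊢
    simpa using this
  · have hn0 : n ≠ 0 := hn.ne'
    have hnR : (1 : ℝ) ≤ n := by exact_mod_cast hn
    have hnR0 : (0 : ℝ) < n := by linarith
    have hvu' := hvu hn0
    set u := (n.factorial : ℝ) / lam ^ (n + 1) with hudef
    have hveq : v = u * lam / n := by rw [eq_div_iff hnR0.ne', hvu']
    refine aux_alg (Real.exp lam) Q (a n) (b (n+1)) (S n) (T n) (S (n+1)) (T (n+1)) (p n)
      u v d (Real.exp_pos _) hQ' (hSs n) (hTs n) (hST n)
      (hp n).le hd0 hd1 (ha0 n) (haS n) (hb0 _) (hbT _) hu0 hv0 ?_ ?_ ?_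
    · refine le_of_mul_le_mul_left ?_ hnR0
      have := mul_le_mul_of_nonneg_left (hTT n) hu0
      calc (n : ℝ) * (u * T (n+1)) = u * (n * T (n+1)) := by ring
        _ ≤ u * (lam * T n) := this
        _ = (v * n) * T n := by rw [hvu']; ring
        _ = _ := by ring
    · refine le_of_mul_le_mul_left ?_ hnR0
      have := mul_le_mul_of_nonneg_left (hSS n) hu0
      calc (n : ℝ) * (v * S n) = (v * n) * S n := by ring
        _ = u * (lam * S n) := by rw [hvu']; ring
        _ ≤ u * (n * S (n+1)) := this
        _ = _ := by ring
    · rw [hu, hv hn0]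
      have h1 : 1 / lam * T (n+1) ≤ 1 / n * T n := by
        rw [one_div, one_div, inv_mul_le_iff₀ hlam, ← mul_assoc, mul_comm lam, mul_assoc,
          le_inv_mul_iff₀ hnR0]
        exact hTT n
      have h2 : 1 / (n : ℝ) * Real.exp lam ≤ Real.exp lam :=
        mul_le_of_le_one_left (Real.exp_pos _).le (by rw [div_le_one hnR0]; exact hnR)
      have h3 := hST n
      rw [h3] at h2 ⊢
      linarith [mul_add (1 / (n : ℝ)) (S n) (T n)]

end
end
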